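/- Fix x_0 ∈ V and n ≥ 2(N_4(x_0) ∨ N_5(x_0)), and write B(σ) := B^ω(x_0, σn) for σ ∈ [1/2,1]. Let u ≥ 0 satisfy L u ≥ 0 on B(1), let φ: V → (0,∞), and set v := φ·u. Then, under the graph assumption, for all α ∈ (0,∞) and all p, q ∈ (1,∞] with 1/p + 1/q < 2/d', there exist γ = γ(d',p,q,α) ∈ (1,∞) and c_{34} = c_{34}(d,p,q,α) ∈ (0,∞) such that for all 1/2 ≤ σ' < σ ≤ 1: max_{x ∈ B(σ')} v(x) ≤ ( c_{34} m^ω(n)/(σ−σ')² )^γ ‖v‖_{α,B(σ)}, where m^ω(n) := ‖1∨μ‖_{p,B^ω(x_0,n)} · ‖1∨ν‖_{q,B^ω(x_0,n)} · (1 + ‖Γ(φ,φ^{−1})‖_{p,B^ω(x_0,n)} n²). -/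

import Mathlib

open MeasureTheory Filter ENNReal Topology
open scoped Classical

namespace FPPPaper

/-! ## Basic geometry of `ℤ^d` -/

/-- Vertices of the lattice `ℤ^d`. -/
abbrev Vert (d : ℕ) := Fin d → ℤ

/-- Nearest-neighbour adjacency on `ℤ^d`. -/
def adj {d : ℕ} (x y : Vert d) : Prop := (∑ i, (x i - y i).natAbs) = 1

/-- The `ℓ^∞`-distance on `ℤ^d`. -/
def linfDist {d : ℕ} (x y : Vert d) : ℕ := Finset.univ.sup fun i => (x i - y i).natAbs

/-- The `ℓ^1`-distance on `ℤ^d`. -/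
def l1Dist {d : ℕ} (x y : Vert d) : ℕ := ∑ i, (x i - y i).natAbs

/-- The canonical embedding `ℤ^d → ℝ^d`. -/
def toRvec {d : ℕ} (x : Vert d) : Fin d → ℝ := fun i => (x i : ℝ)

/-- `p` is a nearest-neighbour path from `x` to `y` (a list of consecutively
adjacent vertices starting at `x` and ending at `y`). -/
def IsPathFrom {d : ℕ} (x y : Vert d) (p : List (Vert d)) : Prop :=
  p.head? = some x ∧ p.getLast? = some y ∧ p.Chain' adj

/-- The (ordered) edges traversed by a path. -/
def edgesOf {d : ℕ} (p : List (Vert d)) : List (Vert d × Vert d) := p.zip p.tail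

/-- Total weight of a path for edge weights `w`. -/
noncomputable def pathWeight {d : ℕ} (w : Vert d → Vert d → ℝ≥0∞) (p : List (Vert d)) :
    ℝ≥0∞ :=
  ((edgesOf p).map fun e => w e.1 e.2).sum

/-- The first passage percolation (pseudo-)distance associated to edge weights `w`. -/
noncomputable def fppDist {d : ℕ} (w : Vert d → Vert d → ℝ≥0∞) (x y : Vert d) : ℝ≥0∞ :=
  ⨅ p : {p : List (Vert d) // IsPathFrom x y p}, pathWeight w p.1

/-- Total weight of a path for vertex weights `w`. -/
noncomputable def vertPathWeight {d : ℕ} (w : Vert d → ℝ≥0∞) (p : List (Vert d)) : ℝ≥0∞ :=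
  (p.map w).sum

/-- The first passage percolation distance associated to vertex weights `w`. -/
noncomputable def vfppDist {d : ℕ} (w : Vert d → ℝ≥0∞) (x y : Vert d) : ℝ≥0∞ :=
  ⨅ p : {p : List (Vert d) // IsPathFrom x y p}, vertPathWeight w p.1

/-- `x` and `y` are connected by a path all of whose edges belong to `S`. -/
def ConnectedIn {d : ℕ} (S : Set (Vert d × Vert d)) (x y : Vert d) : Prop :=
  ∃ p, IsPathFrom x y p ∧ ∀ e ∈ edgesOf p, e ∈ S

/-- `x` and `y` are connected by a path all of whose vertices belong to `S`. -/
def VConnectedIn {d : ℕ} (S : Set (Vert d)) (x y : Vert d) : Prop :=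
  ∃ p, IsPathFrom x y p ∧ ∀ v ∈ p, v ∈ S

/-- The cube `Q(x,r) = {y : |x-y|_∞ ≤ r}`. -/
def cubeVerts {d : ℕ} (x : Vert d) (r : ℝ) : Set (Vert d) :=
  {y | ∀ i, |(y i : ℝ) - (x i : ℝ)| ≤ r}

/-- The set of edges with weight zero. -/
def zeroSet {d : ℕ} (w : Vert d → Vert d → ℝ≥0∞) : Set (Vert d × Vert d) :=
  {e | adj e.1 e.2 ∧ w e.1 e.2 = 0}

/-! ## Configuration spaces indexed by vertices and edges -/

/-- Index set for configurations: vertices and (ordered) edges of `ℤ^d`. -/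
abbrev Coord (d : ℕ) := Vert d ⊕ (Vert d × Vert d)

/-- The vertices underlying a coordinate. -/
def coordVerts {d : ℕ} : Coord d → Set (Vert d)
  | Sum.inl v => {v}
  | Sum.inr e => {e.1, e.2}

/-- The configuration space `Ω = ∏_{e} Ω_e × ∏_x Ω_x` with all coordinate spaces
equal to `Γ`. -/
abbrev Config (d : ℕ) (Γ : Type*) := Coord d → Γ

/-- The lattice shift `τ_z` on configurations. -/
def shiftConfig {d : ℕ} {Γ : Type*} (z : Vert d) (ω : Config d Γ) : Config d Γ :=
  fun c => ω (match c with
    | Sum.inl v => Sum.inl (v + z)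
    | Sum.inr e => Sum.inr (e.1 + z, e.2 + z))

/-- A function of the configuration is supported on the set `S` of coordinates. -/
def SupportedOn {d : ℕ} {Γ β : Type*} (S : Set (Coord d)) (f : Config d Γ → β) : Prop :=
  ∀ ω ω' : Config d Γ, (∀ c ∈ S, ω c = ω' c) → f ω = f ω'

/-- An event on pairs of configurations depending only on the coordinates of the first
configuration in `S1` and of the second one in `S2`. -/
def PairSupportedOn {d : ℕ} {Γ : Type*} (S1 S2 : Set (Coord d))
    (A : Set (Config d Γ × Config d Γ)) : Prop :=
  ∀ ω1 ω2 ω1' ω2' : Config d Γ, (∀ c ∈ S1, ω1 c = ω1' c) → (∀ c ∈ S2, ω2 c = ω2' c) →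
    ((ω1, ω2) ∈ A ↔ (ω1', ω2') ∈ A)

/-- The coordinates of the box `Q̄(x,r)`: vertices of the cube `Q(x,r)` together with
the edges having both endpoints in the cube. -/
def boxCoords {d : ℕ} (x : Vert d) (r : ℝ) : Set (Coord d) :=
  {c | ∀ v ∈ coordVerts c, v ∈ cubeVerts x r}

/-- The coordinates within `ℓ^∞`-distance `r` of `x` or `y` (the neighbourhoods
`𝒩 + x` and `𝒩 + y` together with the edge `{x,y}`). -/
def nbhdCoords {d : ℕ} (r : ℕ) (x y : Vert d) : Set (Coord d) :=
  {c | ∀ v ∈ coordVerts c, linfDist v x ≤ r ∨ linfDist v y ≤ r}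

/-- Two sets of coordinates are at mutual distance at least `r`. -/
def coordSetsFar {d : ℕ} (S1 S2 : Set (Coord d)) (r : ℝ) : Prop :=
  ∀ c1 ∈ S1, ∀ c2 ∈ S2, ∀ v1 ∈ coordVerts c1, ∀ v2 ∈ coordVerts c2,
    r ≤ (linfDist v1 v2 : ℝ)

/-! ## The conditions P1, P2, P3, P3', S1, S2 and Z -/

/-- Condition **P1** (invariance and directional ergodicity): each `P u` is invariant
under lattice shifts and every event invariant under a nonzero shift is trivial. -/
def CondP1 {d : ℕ} {Γ : Type*} [MeasurableSpace Γ]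
    (P : ℝ → Measure (Config d Γ)) (I : Set ℝ) : Prop :=
  ∀ u ∈ I, (∀ z : Vert d, MeasurePreserving (shiftConfig z) (P u) (P u)) ∧
    (∀ z : Vert d, z ≠ 0 → ∀ A : Set (Config d Γ), MeasurableSet A →
      shiftConfig z ⁻¹' A = A → P u A = 0 ∨ P u A = 1)

/-- Condition **P2** (stochastic monotonicity in the parameter `u`). -/
def CondP2 {d : ℕ} {Γ : Type*} [MeasurableSpace Γ] [Preorder Γ]
    (P : ℝ → Measure (Config d Γ)) (I : Set ℝ) : Prop :=
  ∀ f : Config d Γ → ℝ, Measurable f → Monotone f → (∀ ω, f ω ∈ Set.Icc (0:ℝ) 1) →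
    ∀ u ∈ I, ∀ u' ∈ I, u ≤ u' → ∫ ω, f ω ∂(P u) ≤ ∫ ω, f ω ∂(P u')

/-- Condition **P3** (decoupling inequality with sprinkling): after possibly
extending the underlying probability space (the extension is given by `Ω'`, `π`
and the family `Q`), for distant boxes and sprinkled levels there is an event `B`
of high probability on which increasing (resp. decreasing) events on the two boxes
can be compared with their probabilities under independent copies. -/
def CondP3 {d : ℕ} {Γ : Type*} [MeasurableSpace Γ] [Preorder Γ]
    (P : ℝ → Measure (Config d Γ)) (I : Set ℝ)
    (ξP εP aP CP χP RP LP : ℝ) : Prop :=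
  1 < ξP ∧ 0 < εP ∧ 0 < aP ∧ 0 < CP ∧ 0 < χP ∧ 0 < RP ∧ 0 < LP ∧
  ∃ (Ω' : Type) (mΩ' : MeasurableSpace Ω') (π : Ω' → Config d Γ)
    (Q : ℝ → @Measure Ω' mΩ') (fP : ℝ → ℝ),
    (@Measurable Ω' (Config d Γ) mΩ' _ π) ∧
    (∀ u ∈ I, @Measure.map Ω' (Config d Γ) mΩ' _ π (Q u) = P u) ∧
    (∀ L : ℝ, LP ≤ L → Real.exp (aP * Real.log L ^ εP) ≤ fP L) ∧
    ∀ (R L : ℝ) (x1 x2 : Vert d) (u uh : ℝ), u ∈ I → uh ∈ I → RP ≤ R → LP ≤ L →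
      (∀ v1 ∈ cubeVerts x1 (L ^ ξP), ∀ v2 ∈ cubeVerts x2 (L ^ ξP),
        R * L ≤ (linfDist v1 v2 : ℝ)) →
      uh + R ^ (-χP) ≤ u →
      ∃ B : Set Ω', @MeasurableSet Ω' mΩ' B ∧
        Q u Bᶜ ≤ ENNReal.ofReal (Real.exp (-(CP * fP L))) ∧
        (∀ A : Set (Config d Γ × Config d Γ), MeasurableSet A → IsUpperSet A →
            PairSupportedOn (boxCoords x1 (L ^ ξP)) (boxCoords x2 (L ^ ξP)) A →
            Q uh {ω' | ω' ∈ B ∧ (π ω', π ω') ∈ A} ≤ ((P u).prod (P u)) A) ∧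
        (∀ A : Set (Config d Γ × Config d Γ), MeasurableSet A → IsLowerSet A →
            PairSupportedOn (boxCoords x1 (L ^ ξP)) (boxCoords x2 (L ^ ξP)) A →
            Q u {ω' | ω' ∈ B ∧ (π ω', π ω') ∈ A} ≤ ((P uh).prod (P uh)) A)

/-- Condition **P3'** (decoupling inequality for sparse sets with super-exponential
error term). -/
def CondP3' {d : ℕ} {Γ : Type*} [MeasurableSpace Γ] [Preorder Γ]
    (P : ℝ → Measure (Config d Γ)) (I : Set ℝ)
    (ξP CP χP RP LP : ℝ) : Prop :=
  1 < ξP ∧ 0 < CP ∧ 0 < χP ∧ 0 < RP ∧ 0 < LP ∧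
  ∀ (R L : ℝ) (x1 x2 : Vert d) (u uh : ℝ), u ∈ I → uh ∈ I → RP ≤ R → LP ≤ L →
    uh + R ^ (-χP) ≤ u →
    ∀ S1 S2 : Set (Coord d), S1 ⊆ boxCoords x1 (L ^ ξP) → S2 ⊆ boxCoords x2 (L ^ ξP) →
      (S1.ncard : ℝ) ≤ L ^ ξP → (S2.ncard : ℝ) ≤ L ^ ξP →
      coordSetsFar S1 S2 (R * L) →
      (∀ f1 f2 : Config d Γ → ℝ, Measurable f1 → Measurable f2 →
        Monotone f1 → Monotone f2 →
        (∀ ω, f1 ω ∈ Set.Icc (0:ℝ) 1) → (∀ ω, f2 ω ∈ Set.Icc (0:ℝ) 1) →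
        SupportedOn S1 f1 → SupportedOn S2 f2 →
        ∫ ω, f1 ω * f2 ω ∂(P uh) ≤ (∫ ω, f1 ω ∂(P u)) * (∫ ω, f2 ω ∂(P u))
          + Real.exp (-(CP * L ^ ξP))) ∧
      (∀ f1 f2 : Config d Γ → ℝ, Measurable f1 → Measurable f2 →
        Antitone f1 → Antitone f2 →
        (∀ ω, f1 ω ∈ Set.Icc (0:ℝ) 1) → (∀ ω, f2 ω ∈ Set.Icc (0:ℝ) 1) →
        SupportedOn S1 f1 → SupportedOn S2 f2 →
        ∫ ω, f1 ω * f2 ω ∂(P u) ≤ (∫ ω, f1 ω ∂(P uh)) * (∫ ω, f2 ω ∂(P uh))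
          + Real.exp (-(CP * L ^ ξP)))

/-- Condition **(Z)**: `liminf_{L→∞} sup_x P^u(Q(x,L) ↔ Q(x,2L)^c in {e : t_e = 0}) = 0`
for every `u ∈ I`. -/
def CondZ {d : ℕ} {Γ : Type*} [MeasurableSpace Γ]
    (P : ℝ → Measure (Config d Γ)) (I : Set ℝ)
    (w : Config d Γ → Vert d → Vert d → ℝ≥0∞) : Prop :=
  ∀ u ∈ I,
    Filter.liminf (fun L : ℕ =>
      ⨆ x : Vert d, P u {ω | ∃ v1 ∈ cubeVerts x (L : ℝ), ∃ v2,
        v2 ∉ cubeVerts x ((2 * L : ℕ) : ℝ) ∧ ConnectedIn (zeroSet (w ω)) v1 v2})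
      Filter.atTop = 0

/-- The function `g_P^{(δ)}` of the main theorem: equal to `L` if condition P3' holds
and otherwise given by the P3-formula. -/
noncomputable def gP3formula (δ εP aP χP L : ℝ) : ℝ :=
  min L (Real.log L ^ (-(δ * (1 + aP + aP / χP))) * Real.exp (aP * Real.log L ^ εP))

noncomputable def gdelta (p3' : Prop) (δ εP aP χP L : ℝ) : ℝ :=
  if p3' then L else gP3formula δ εP aP χP L

/-! ## The renormalization scheme -/

/-- `ρ_k = ρ` for `k < K` and `ρ_k = 1` for `k ≥ K`. -/
def rhok (ρ K k : ℕ) : ℕ := if k < K then ρ else 1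

/-- The sequence of scales `L_{k+1} = 2 L_k (1 + ρ_k/(k+6)^δ)`. -/
noncomputable def Lseq (δ : ℝ) (ρ K : ℕ) (L0 : ℝ) : ℕ → ℝ
  | 0 => L0
  | k + 1 => 2 * Lseq δ ρ K L0 k * (1 + (rhok ρ K k : ℝ) / ((k : ℝ) + 6) ^ δ)

/-- The box `C_x^k = x + [0, L_k)^d ∩ ℤ^d`. -/
def CkSet {d : ℕ} (δ : ℝ) (ρ K : ℕ) (L0 : ℝ) (k : ℕ) (x : Vert d) : Set (Vert d) :=
  {y | ∀ i, (0:ℝ) ≤ ((y i - x i : ℤ) : ℝ) ∧ ((y i - x i : ℤ) : ℝ) < Lseq δ ρ K L0 k}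

/-- The box `D_x^k = x + [-L_k, 2 L_k)^d ∩ ℤ^d`. -/
def DkSet {d : ℕ} (δ : ℝ) (ρ K : ℕ) (L0 : ℝ) (k : ℕ) (x : Vert d) : Set (Vert d) :=
  {y | ∀ i, -(Lseq δ ρ K L0 k) ≤ ((y i - x i : ℤ) : ℝ) ∧
    ((y i - x i : ℤ) : ℝ) < 2 * Lseq δ ρ K L0 k}

/-- `d_k^ω(x)`: the FPP distance between `C_x^k` and the complement of `D_x^k`. -/
noncomputable def dkDist {d : ℕ} (δ : ℝ) (ρ K : ℕ) (L0 : ℝ) (k : ℕ) (x : Vert d)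
    (w : Vert d → Vert d → ℝ≥0∞) : ℝ≥0∞ :=
  ⨅ p : {p : List (Vert d) // ∃ a b, a ∈ CkSet δ ρ K L0 k x ∧ b ∉ DkSet δ ρ K L0 k x ∧
      IsPathFrom a b p}, pathWeight w p.1

/-- `ε_k = Σ_{p ≥ k} ε/(p+6)^δ`. -/
noncomputable def epsk (δ ε : ℝ) (k : ℕ) : ℝ :=
  ∑' j : ℕ, ε / (((k + j : ℕ) : ℝ) + 6) ^ δ

/-- `a_k = 2^k ∏_{i=0}^{k-1} (1 - 1/(i+6)^δ)`. -/
noncomputable def aseq (δ : ℝ) (k : ℕ) : ℝ :=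
  2 ^ k * ∏ i ∈ Finset.range k, (1 - 1 / (((i : ℕ) : ℝ) + 6) ^ δ)

/-- A path visits `A` and visits the complement of `B` ("the path connects `A` to
`B^c`"). -/
def Crosses {d : ℕ} (p : List (Vert d)) (A B : Set (Vert d)) : Prop :=
  (∃ v ∈ p, v ∈ A) ∧ (∃ v ∈ p, v ∉ B)

/-- Two sets of vertices at mutual `ℓ^∞`-distance at least `r`. -/
def SetDistGE {d : ℕ} (A B : Set (Vert d)) (r : ℝ) : Prop :=
  ∀ a ∈ A, ∀ b ∈ B, r ≤ (linfDist a b : ℝ)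

/-- A proper embedding of the binary tree of depth `k` with base `x`, where tree
vertices of depth `n` are encoded as lists of booleans of length `n` and children
are obtained by appending a bit. -/
def ProperEmbedding {d : ℕ} (δ : ℝ) (ρ K : ℕ) (L0 : ℝ)
    (xseq yseq : ℕ → ℕ → Vert d) (k : ℕ) (x : Vert d) (τ : List Bool → Vert d) : Prop :=
  τ [] = x ∧
  (∀ n, n < k → ∀ σ : List Bool, σ.length = n →
    ∃ i < (2 + rhok ρ K (k - n - 1)) ^ d, ∃ j < 2 * d * (6 + rhok ρ K (k - n - 1)) ^ (d - 1),
      τ (σ ++ [true]) = τ σ + xseq (k - n - 1) i ∧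
      τ (σ ++ [false]) = τ σ + yseq (k - n - 1) j) ∧
  (∀ n, n < k → ∀ σ σ' : List Bool, σ.length = n → σ'.length = k - n →
    (DkSet δ ρ K L0 (k - n) (τ σ) ∩ DkSet δ ρ K L0 0 (τ (σ ++ σ'))).Nonempty)

/-- The countable product measure `ν = μ^{⊗ℕ}` characterised on cylinders. -/
def IsIIDProduct {Ω : Type*} [MeasurableSpace Ω] (μ : Measure Ω)
    (ν : Measure (ℕ → Ω)) : Prop :=
  ∀ (s : Finset ℕ) (f : ℕ → Set Ω), (∀ i ∈ s, MeasurableSet (f i)) →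
    ν {ωt | ∀ i ∈ s, ωt i ∈ f i} = ∏ i ∈ s, μ (f i)

/-- The Lorentz `L(d,1)`-norm of a nonnegative random variable. -/
noncomputable def lorentzNorm {Ω : Type*} [MeasurableSpace Ω] (d : ℕ) (P : Measure Ω)
    (X : Ω → ℝ≥0∞) : ℝ≥0∞ :=
  ∫⁻ s in Set.Ioi (0:ℝ), (P {ω | ENNReal.ofReal s < X ω}) ^ ((1:ℝ) / d)

/-! ## The discrete Gaussian free field -/

/-- The neighbours of a vertex of `ℤ^d`. -/
def nbrs {d : ℕ} (x : Vert d) : Finset (Vert d) :=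
  (Finset.univ : Finset (Fin d × Bool)).image
    (fun p => Function.update x p.1 (x p.1 + if p.2 then 1 else -1))

/-- The number of nearest-neighbour walks of length `n` from `x` to `y`. -/
def nStepCount (d : ℕ) : ℕ → Vert d → Vert d → ℕ
  | 0, x, y => if x = y then 1 else 0
  | n + 1, x, y => ∑ z ∈ nbrs x, nStepCount d n z y

/-- The Green function of the simple random walk on `ℤ^d` (with unit weights). -/
noncomputable def greenSRW (d : ℕ) (x y : Vert d) : ℝ≥0∞ :=
  ∑' n : ℕ, (nStepCount d n x y : ℝ≥0∞) / ((2 * d : ℕ) : ℝ≥0∞) ^ n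

/-- `φ` is a centred Gaussian field with covariance `cov` under `P`, characterised by
the moment generating functions of its finite linear combinations. -/
def IsCenteredGaussianField {d : ℕ} {Ω : Type*} [MeasurableSpace Ω] (P : Measure Ω)
    (φ : Ω → Vert d → ℝ) (cov : Vert d → Vert d → ℝ) : Prop :=
  (∀ x, Measurable fun ω => φ ω x) ∧
  ∀ (s : Finset (Vert d)) (c : Vert d → ℝ) (t : ℝ),
    ∫ ω, Real.exp (t * ∑ x ∈ s, c x * φ ω x) ∂P =
      Real.exp (t ^ 2 * (∑ x ∈ s, ∑ y ∈ s, c x * c y * cov x y) / 2)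

/-- The set `S` of vertices percolates (contains an infinite cluster). -/
def PercolatesIn {d : ℕ} (S : Set (Vert d)) : Prop :=
  ∃ x, {y | VConnectedIn S x y}.Infinite

/-- The critical level `h_*` for level-set percolation of the field `φ`. -/
noncomputable def hstar {d : ℕ} {Ω : Type*} [MeasurableSpace Ω] (P : Measure Ω)
    (φ : Ω → Vert d → ℝ) : ℝ :=
  sSup {h : ℝ | P {ω | PercolatesIn {x | h ≤ φ ω x}} ≠ 0}

/-- `h_f = inf {t : f t = 0}` as an extended real number (`⊤` if `f` has no zero). -/
noncomputable def hfEReal (f : ℝ → ℝ) : EReal :=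
  sInf {x : EReal | ∃ s : ℝ, f s = 0 ∧ x = (s : EReal)}

/-! ## Random conductance models -/

/-- An edge is open for conductances `a` if it is a lattice edge with positive
conductance. -/
def openAdj {d : ℕ} (a : Vert d → Vert d → ℝ) (x y : Vert d) : Prop :=
  adj x y ∧ 0 < a x y

/-- A path using only open edges. -/
def IsOpenPath {d : ℕ} (a : Vert d → Vert d → ℝ) (x y : Vert d) (p : List (Vert d)) :
    Prop :=
  p.head? = some x ∧ p.getLast? = some y ∧ p.Chain' (openAdj a)

/-- Connectivity by open paths. -/
def openConn {d : ℕ} (a : Vert d → Vert d → ℝ) (x y : Vert d) : Prop :=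
  ∃ p, IsOpenPath a x y p

/-- The union of the infinite open clusters (the infinite cluster `C_∞` when it is
unique). -/
def Cinf {d : ℕ} (a : Vert d → Vert d → ℝ) : Set (Vert d) :=
  {x | {y | openConn a x y}.Infinite}

/-- The chemical (graph) distance on the open cluster. -/
noncomputable def chemDist {d : ℕ} (a : Vert d → Vert d → ℝ) (x y : Vert d) : ℝ≥0∞ :=
  ⨅ p : {p : List (Vert d) // IsOpenPath a x y p}, ((p.1.length - 1 : ℕ) : ℝ≥0∞)

/-- The closed ball of radius `r` for the chemical distance. -/
def ballCh {d : ℕ} (a : Vert d → Vert d → ℝ) (x : Vert d) (r : ℝ) : Set (Vert d) :=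
  {y | chemDist a x y ≤ ENNReal.ofReal r}

/-- `μ^ω(x) = Σ_{y∼x} a(x,y)`. -/
noncomputable def muA {d : ℕ} (a : Vert d → Vert d → ℝ) (x : Vert d) : ℝ :=
  ∑ y ∈ nbrs x, a x y

/-- `ν^ω(x) = Σ_{y∼x, a(x,y)>0} a(x,y)⁻¹`. -/
noncomputable def nuA {d : ℕ} (a : Vert d → Vert d → ℝ) (x : Vert d) : ℝ :=
  ∑ y ∈ nbrs x, if 0 < a x y then (a x y)⁻¹ else 0

/-- The space-averaged `ℓ^p`-norm `‖f‖_{p,A}` (maximum norm for `p = ∞`). -/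
noncomputable def avgNormR {d : ℕ} (p : ℝ≥0∞) (A : Set (Vert d)) (f : Vert d → ℝ) : ℝ :=
  if p = ∞ then sSup ((fun x => |f x|) '' A)
  else ((∑' x : A, |f (x : Vert d)| ^ p.toReal) / (A.ncard : ℝ)) ^ (1 / p.toReal)

/-- The sum `Σ_{{y,z} open edge} |f(y) - f(z)|` (each unordered edge counted once). -/
noncomputable def edgeGradSum {d : ℕ} (a : Vert d → Vert d → ℝ) (f : Vert d → ℝ) : ℝ :=
  (1 / 2) * ∑' e : Vert d × Vert d, if openAdj a e.1 e.2 then |f e.2 - f e.1| else 0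

/-- The graph assumption: volume regularity of order `d` and a Sobolev inequality
with exponent `d' ≥ d` on large balls of the infinite cluster. -/
def GraphAssumption {d : ℕ} (d' : ℝ) (a : Vert d → Vert d → ℝ)
    (N4 N5 : Vert d → ℕ) (Creg CS1 : ℝ) : Prop :=
  1 ≤ Creg ∧ 1 ≤ CS1 ∧ (d : ℝ) ≤ d' ∧
  (∀ x ∈ Cinf a, ∀ n : ℕ, N4 x ≤ n →
    Creg⁻¹ * (n : ℝ) ^ d ≤ ((ballCh a x n).ncard : ℝ) ∧
      ((ballCh a x n).ncard : ℝ) ≤ Creg * (n : ℝ) ^ d) ∧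
  (∀ x ∈ Cinf a, ∀ n : ℕ, N5 x ≤ n → ∀ f : Vert d → ℝ,
    (∀ y, f y ≠ 0 → y ∈ ballCh a x n) →
    avgNormR (ENNReal.ofReal (d' / (d' - 1))) (ballCh a x n) f ≤
      CS1 * n / ((ballCh a x n).ncard : ℝ) * edgeGradSum a f)

/-- The generator `(ℒ f)(x) = Σ_{y∼x} a(x,y)(f(y)-f(x)) - h κ(x) f(x)`. -/
noncomputable def genL {d : ℕ} (a : Vert d → Vert d → ℝ) (κ : Vert d → ℝ) (h : ℝ)
    (f : Vert d → ℝ) (x : Vert d) : ℝ :=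
  (∑ y ∈ nbrs x, a x y * (f y - f x)) - h * κ x * f x

/-- The carré du champ `Γ(f,g)(x) = Σ_{y∼x} a(x,y)(f(y)-f(x))(g(y)-g(x))`. -/
noncomputable def carre {d : ℕ} (a : Vert d → Vert d → ℝ) (f g : Vert d → ℝ)
    (x : Vert d) : ℝ :=
  ∑ y ∈ nbrs x, a x y * (f y - f x) * (g y - g x)

/-- The weighted carré du champ
`Γ_η(f,g)(x) = Σ_{y∼x} av(η²)({x,y}) a(x,y)(f(y)-f(x))(g(y)-g(x))`. -/
noncomputable def carreEta {d : ℕ} (a : Vert d → Vert d → ℝ) (η f g : Vert d → ℝ)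
    (x : Vert d) : ℝ :=
  ∑ y ∈ nbrs x, ((η x ^ 2 + η y ^ 2) / 2) * (a x y * (f y - f x) * (g y - g x))

/-- The Dirichlet form `E(f) = ⟨∇f, a ∇f⟩ + h ⟨f, κ f⟩`. -/
noncomputable def dirichletE {d : ℕ} (a : Vert d → Vert d → ℝ) (κ : Vert d → ℝ)
    (h : ℝ) (f : Vert d → ℝ) : ℝ :=
  (1 / 2) * (∑' e : Vert d × Vert d,
      if adj e.1 e.2 then a e.1 e.2 * (f e.2 - f e.1) ^ 2 else 0) +
    h * ∑' x, κ x * f x ^ 2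

/-- `g` is the Green function on `C` of the walk with conductances `a` and killing
measure `h·κ`: the minimal nonnegative fundamental solution of `ℒ g(·,y) = -𝟙_y`. -/
def IsGreenFn {d : ℕ} (a : Vert d → Vert d → ℝ) (κ : Vert d → ℝ) (h : ℝ)
    (C : Set (Vert d)) (g : Vert d → Vert d → ℝ) : Prop :=
  (∀ x y, 0 ≤ g x y) ∧
  (∀ y ∈ C, ∀ x ∈ C, genL a κ h (fun z => g z y) x = -(if x = y then (1:ℝ) else 0)) ∧
  (∀ g' : Vert d → Vert d → ℝ, (∀ x y, 0 ≤ g' x y) →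
    (∀ y ∈ C, ∀ x ∈ C, genL a κ h (fun z => g' z y) x ≤ -(if x = y then (1:ℝ) else 0)) →
    ∀ x ∈ C, ∀ y ∈ C, g x y ≤ g' x y)

/-- `q t x y = P_x(X_t = y)` is the (minimal) transition function of the Markov chain
with jump rates `a(x,y)/θ(x)`, characterised via the backward Kolmogorov equations. -/
def IsHeatSemigroup {d : ℕ} (a : Vert d → Vert d → ℝ) (θ : Vert d → ℝ)
    (q : ℝ → Vert d → Vert d → ℝ) : Prop :=
  (∀ x y, q 0 x y = if x = y then (1:ℝ) else 0) ∧
  (∀ t x y, 0 ≤ q t x y) ∧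
  (∀ t x, ∑' y, q t x y ≤ 1) ∧
  (∀ x y, ∀ t : ℝ, 0 ≤ t →
    HasDerivAt (fun s => q s x y) (∑ z ∈ nbrs x, a x z / θ x * (q t z y - q t x y)) t) ∧
  (∀ q' : ℝ → Vert d → Vert d → ℝ,
    (∀ x y, q' 0 x y = if x = y then (1:ℝ) else 0) →
    (∀ t x y, 0 ≤ q' t x y) →
    (∀ x y, ∀ t : ℝ, 0 ≤ t →
      HasDerivAt (fun s => q' s x y)
        (∑ z ∈ nbrs x, a x z / θ x * (q' t z y - q' t x y)) t) →
    ∀ t : ℝ, 0 ≤ t → ∀ x y, q t x y ≤ q' t x y)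

/-- The FPP edge weight `(1 ∧ (κ(x) ∧ κ(y))/a(x,y))^{1/2}` (equal to `∞` on closed
edges); used both for the metric `d_κ` and, with `θ` in place of `κ`, for `d_θ`. -/
noncomputable def kapWeightE {d : ℕ} (a : Vert d → Vert d → ℝ) (κ : Vert d → ℝ)
    (x y : Vert d) : ℝ≥0∞ :=
  if 0 < a x y then ENNReal.ofReal (Real.sqrt (min 1 (min (κ x) (κ y) / a x y))) else ∞

/-- The FPP-type metric `d_κ` on the open cluster. -/
noncomputable def dkap {d : ℕ} (a : Vert d → Vert d → ℝ) (κ : Vert d → ℝ)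
    (x y : Vert d) : ℝ≥0∞ :=
  ⨅ p : {p : List (Vert d) // IsOpenPath a x y p},
    ((edgesOf p.1).map fun e => kapWeightE a κ e.1 e.2).sum

/-- `F_γ(r) = (1+r)^γ (1+1/r)^{1/2}` in `ℝ≥0∞` (so `F_γ(0) = ∞`). -/
noncomputable def FgamE (γ r : ℝ) : ℝ≥0∞ :=
  (1 + ENNReal.ofReal r) ^ γ * (1 + (ENNReal.ofReal r)⁻¹) ^ ((1:ℝ) / 2)

/-- The open cluster of `x` has `ℓ^1`-diameter at least `r`. -/
def clusterDiamGE {d : ℕ} (a : Vert d → Vert d → ℝ) (x : Vert d) (r : ℝ) : Prop :=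
  ∃ y z, openConn a x y ∧ openConn a x z ∧ r ≤ (l1Dist y z : ℝ)

/-- Condition **S1** (local uniqueness of large clusters). -/
def CondS1 {d : ℕ} {Γ : Type*} [MeasurableSpace Γ]
    (P : ℝ → Measure (Config d Γ)) (I : Set ℝ)
    (aC : Config d Γ → Vert d → Vert d → ℝ) : Prop :=
  ∃ fS : ℝ → ℕ → ℝ, ∀ u ∈ I, ∃ ΔS RS : ℝ, 0 < ΔS ∧
    (∀ R : ℕ, RS ≤ R → Real.log (R : ℝ) ^ (1 + ΔS) ≤ fS u R) ∧
    ∀ R : ℕ, 1 ≤ R →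
      (ENNReal.ofReal (1 - Real.exp (-(fS u R))) ≤
        P u {ω | ∃ x ∈ cubeVerts (0 : Vert d) (R : ℝ), clusterDiamGE (aC ω) x (R : ℝ)}) ∧
      (ENNReal.ofReal (1 - Real.exp (-(fS u R))) ≤
        P u {ω | ∀ x ∈ cubeVerts (0 : Vert d) (R : ℝ), ∀ y ∈ cubeVerts (0 : Vert d) (R : ℝ),
          clusterDiamGE (aC ω) x ((R : ℝ) / 10) → clusterDiamGE (aC ω) y ((R : ℝ) / 10) →
          ∃ p, IsOpenPath (aC ω) x y p ∧ ∀ v ∈ p, v ∈ cubeVerts (0 : Vert d) ((2 * R : ℕ) : ℝ)})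

/-- Condition **S2**: `u ↦ P^u(0 ∈ C_∞)` is positive and continuous on `I`. -/
def CondS2 {d : ℕ} {Γ : Type*} [MeasurableSpace Γ]
    (P : ℝ → Measure (Config d Γ)) (I : Set ℝ)
    (aC : Config d Γ → Vert d → Vert d → ℝ) : Prop :=
  (∀ u ∈ I, 0 < P u {ω | (0 : Vert d) ∈ Cinf (aC ω)}) ∧
  ContinuousOn (fun u => (P u {ω | (0 : Vert d) ∈ Cinf (aC ω)}).toReal) I

/-- Weighted `p`-th moment `E[X^p w]` (essential supremum of `X` for `p = ∞`). -/
noncomputable def wMoment {Ω : Type*} [MeasurableSpace Ω] (μm : Measure Ω) (p : ℝ≥0∞)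
    (X w : Ω → ℝ≥0∞) : ℝ≥0∞ :=
  if p = ∞ then essSup X μm else ∫⁻ ω, X ω ^ p.toReal * w ω ∂μm

/-- `p_* = p/(p-1)` (with `∞_* = 1`). -/
noncomputable def pstar (p : ℝ≥0∞) : ℝ≥0∞ :=
  if p = ∞ then 1 else ENNReal.ofReal (p.toReal / (p.toReal - 1))

/-- `‖∇η‖_{ℓ^∞(E)}`: the supremum of `|η(y)-η(x)|` over open edges. -/
noncomputable def gradSup {d : ℕ} (a : Vert d → Vert d → ℝ) (η : Vert d → ℝ) : ℝ :=
  sSup {r : ℝ | ∃ x y, openAdj a x y ∧ r = |η y - η x|}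

/-- `exp(-ζ x)` for `x ∈ ℝ≥0∞` (equal to `0` at `x = ∞`). -/
noncomputable def expNegE (ζ : ℝ) (x : ℝ≥0∞) : ℝ≥0∞ :=
  if x = ∞ then 0 else ENNReal.ofReal (Real.exp (-(ζ * x.toReal)))

/-- The `m^ω(n)` factor of the maximal inequality. -/
noncomputable def mBound {d : ℕ} (a : Vert d → Vert d → ℝ) (p q : ℝ≥0∞)
    (phi : Vert d → ℝ) (x0 : Vert d) (n : ℕ) : ℝ :=
  avgNormR p (ballCh a x0 (n : ℝ)) (fun x => max 1 (muA a x)) *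
    avgNormR q (ballCh a x0 (n : ℝ)) (fun x => max 1 (nuA a x)) *
    (1 + avgNormR p (ballCh a x0 (n : ℝ)) (carre a phi fun z => (phi z)⁻¹) * (n : ℝ) ^ 2)

/-- The Caccioppoli estimate with constant `c35` (for the data `a`, `κ`, `h`). -/
def CaccEst {d : ℕ} (a : Vert d → Vert d → ℝ) (κ : Vert d → ℝ) (h : ℝ) (c35 : ℝ) :
    Prop :=
  ∀ B : Set (Vert d), B.Finite → B ⊆ Cinf a →
    (∀ x ∈ B, ∀ y ∈ B, ∃ p, IsOpenPath a x y p ∧ ∀ v ∈ p, v ∈ B) →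
  ∀ η : Vert d → ℝ, (∀ x, η x ∈ Set.Icc (0:ℝ) 1) → (∀ x, η x ≠ 0 → x ∈ B) →
    (∀ x ∈ B, (∃ y, y ∉ B ∧ openAdj a x y) → η x = 0) →
  ∀ u : Vert d → ℝ, (∀ x, 0 ≤ u x) → (∀ x ∈ B, 0 ≤ genL a κ h u x) →
  ∀ phi : Vert d → ℝ, (∀ x, 0 < phi x) →
  ∀ α : ℝ, 1 ≤ α →
    dirichletE a κ h (fun x => η x * (phi x * u x) ^ α) ≤
      c35 * α ^ 2 * ∑' x, (phi x * u x) ^ (2 * α) *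
        (carre a η η x - carreEta a η phi (fun z => (phi z)⁻¹) x)

lemma rpow_sub_le {ζ x y : ℝ} (hζ : 1 ≤ ζ) (hx : 0 ≤ x) (hxy : x ≤ y) :
    y ^ ζ - x ^ ζ ≤ ζ * y ^ (ζ - 1) * (y - x) := by
  rcases eq_or_lt_of_le (hx.trans hxy) with h0 | hy
  · have : x = 0 := by linarith
    subst this; rw [← h0]; simp
  have hb := one_add_mul_self_le_rpow_one_add (s := x / y - 1) (by
    have : 0 ≤ x / y := by positivity
    linarith) hζ
  have h1 : (1 + (x / y - 1)) = x / y := by ring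
  rw [h1, Real.div_rpow hx hy.le] at hb
  have hyz : 0 < y ^ ζ := Real.rpow_pos_of_pos hy _
  rw [le_div_iff₀ hyz] at hb
  have h2 : y ^ ζ = y ^ (ζ - 1) * y := by
    rw [← Real.rpow_add_one hy.ne']; ring_nf
  have h3 : (1 + ζ * (x / y - 1)) * y ^ ζ = y ^ ζ - ζ * y ^ (ζ - 1) * (y - x) := by
    rw [h2]; field_simp; ring
  linarith

lemma abs_rpow_sub_le {ζ x y : ℝ} (hζ : 1 ≤ ζ) (hx : 0 ≤ x) (hy : 0 ≤ y) :
    |y ^ ζ - x ^ ζ| ≤ ζ * (|y - x| * (x ^ (ζ - 1) + y ^ (ζ - 1))) := by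
  have px : 0 ≤ x ^ (ζ - 1) := Real.rpow_nonneg hx _
  have py : 0 ≤ y ^ (ζ - 1) := Real.rpow_nonneg hy _
  rcases le_total x y with h | h
  · have := rpow_sub_le hζ hx h
    rw [abs_of_nonneg (sub_nonneg.2 (Real.rpow_le_rpow hx h (by linarith))), abs_of_nonneg (sub_nonneg.2 h)]
    refine this.trans ?_
    have : 0 ≤ ζ * ((y - x) * x ^ (ζ - 1)) :=
      mul_nonneg (by linarith) (mul_nonneg (by linarith) px)
    nlinarith
  · have := rpow_sub_le hζ hy h
    rw [abs_sub_comm, abs_sub_comm y x, abs_of_nonneg (sub_nonneg.2 (Real.rpow_le_rpow hy h (by linarith))), abs_of_nonneg (sub_nonneg.2 h)]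
    refine this.trans ?_
    have : 0 ≤ ζ * ((x - y) * y ^ (ζ - 1)) :=
      mul_nonneg (by linarith) (mul_nonneg (by linarith) py)
    nlinarith

/-- power facts -/
lemma pow_facts {α x y : ℝ} (hα : 1 ≤ α) (hx : 0 ≤ x) (hxy : x ≤ y) :
    (y ^ α - x ^ α) ^ 2 ≤ α * ((y ^ (2 * α - 1) - x ^ (2 * α - 1)) * (y - x)) := by
  have hy := hx.trans hxy
  have h1 := rpow_sub_le hα hx hxy
  have h0 : 0 ≤ y ^ α - x ^ α := sub_nonneg.2 (Real.rpow_le_rpow hx hxy (by linarith))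
  have key : ∀ z : ℝ, 0 ≤ z → z ^ (α - 1) * z ^ α = z ^ (2 * α - 1) := by
    intro z hz
    rw [← Real.rpow_add_of_nonneg hz (by linarith) (by linarith)]; ring_nf
  have h2 : y ^ (α - 1) * (y ^ α - x ^ α) ≤ y ^ (2 * α - 1) - x ^ (2 * α - 1) := by
    rw [mul_sub, key y hy, ← key x hx]
    have := Real.rpow_le_rpow hx hxy (show 0 ≤ α - 1 by linarith)
    have h3 := Real.rpow_nonneg hx α
    nlinarith
  calc (y ^ α - x ^ α) ^ 2 = (y ^ α - x ^ α) * (y ^ α - x ^ α) := by ring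
    _ ≤ (α * y ^ (α - 1) * (y - x)) * (y ^ α - x ^ α) := by gcongr
    _ = α * (y - x) * (y ^ (α - 1) * (y ^ α - x ^ α)) := by ring
    _ ≤ α * (y - x) * (y ^ (2 * α - 1) - x ^ (2 * α - 1)) := by
        apply mul_le_mul_of_nonneg_left h2
        exact mul_nonneg (by linarith) (by linarith)
    _ = _ := by ring

set_option maxHeartbeats 1600000 in
lemma edge_alg {α vx vy bx bY wx wy ηx ηy S g : ℝ} (hα : 1 ≤ α)
    (hvx : 0 ≤ vx) (hvy : 0 ≤ vy) (hbx : 0 ≤ bx) (hby : 0 ≤ bY)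
    (hwx : 0 ≤ wx) (hwy : 0 ≤ wy) (hx : bx * vx = wx ^ 2) (hy : bY * vy = wy ^ 2)
    (H2 : (wy - wx) ^ 2 ≤ α * ((bY - bx) * (vy - vx)))
    (Hs : (bx ≤ bY ∧ vx ≤ vy ∧ wx ≤ wy) ∨ (bY ≤ bx ∧ vy ≤ vx ∧ wy ≤ wx))
    (hηx : 0 ≤ ηx) (hηx1 : ηx ≤ 1) (hηy : 0 ≤ ηy) (hηy1 : ηy ≤ 1)
    (hg : 0 ≤ g) (hS : S ^ 2 = g + g ^ 2 / 4) :
    (ηy * wy - ηx * wx) ^ 2 ≤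
      4 * α * ((ηy ^ 2 * bY - ηx ^ 2 * bx) * (vy - vx) - ηy ^ 2 * bY * vx * (S + g / 2)
        - ηx ^ 2 * bx * vy * (-S + g / 2)) +
      37 * α ^ 2 * ((g + (ηy - ηx) ^ 2) * (wx ^ 2 + wy ^ 2)) := by
  obtain ⟨k, hk, hkg⟩ : ∃ k : ℝ, 0 ≤ k ∧ k ^ 2 = g := ⟨√g, Real.sqrt_nonneg _, Real.sq_sqrt hg⟩
  have hSabs : |S| ≤ k + g / 2 := by
    apply abs_le_of_sq_le_sq _ (by positivity)
    rw [hS, ← hkg]; linarith [pow_nonneg hk 3]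
  set P := bY * vx with hP
  set Q := bx * vy with hQ
  have hP0 : 0 ≤ P := by positivity
  have hQ0 : 0 ≤ Q := by positivity
  set δ := |wy - wx| with hδ
  set Sg := wx + wy with hSg
  set w2 := wx ^ 2 + wy ^ 2 with hw2
  have hw20 : 0 ≤ w2 := by positivity
  have hSg2 : Sg ^ 2 ≤ 2 * w2 := by rw [hSg, hw2]; linarith [sq_nonneg (wx - wy)]
  have hSg0 : 0 ≤ Sg := by positivity
  have hδ0 : 0 ≤ δ := abs_nonneg _
  have hδ2 : δ ^ 2 = (wy - wx) ^ 2 := sq_abs _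
  have hPQ : P + Q ≤ w2 := by
    rw [hw2, ← hx, ← hy, hP, hQ]
    rcases Hs with ⟨h1, h2, _⟩ | ⟨h1, h2, _⟩ <;> linarith [mul_nonneg (sub_nonneg.2 h1) (sub_nonneg.2 h2)]
  have H3 : |P - Q| ≤ δ * Sg := by
    rcases Hs with ⟨h1, h2, h3⟩ | ⟨h1, h2, h3⟩
    · rw [hδ, abs_of_nonneg (by linarith : 0 ≤ wy - wx)]
      have e : (wy - wx) * Sg = bY * vy - bx * vx := by rw [hx, hy, hSg]; ring
      rw [e, abs_le, hP, hQ]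
      have f1 := mul_nonneg hby (sub_nonneg.2 h2)
      have f2 := mul_nonneg hbx (sub_nonneg.2 h2)
      have f3 := mul_nonneg (sub_nonneg.2 h1) hvx
      have f4 := mul_nonneg (sub_nonneg.2 h1) hvy
      constructor <;> linarith
    · rw [hδ, abs_of_nonpos (by linarith : wy - wx ≤ 0)]
      have e : -(wy - wx) * Sg = bx * vx - bY * vy := by rw [hx, hy, hSg]; ring
      rw [e, abs_le, hP, hQ]
      have f1 := mul_nonneg hby (sub_nonneg.2 h2)
      have f2 := mul_nonneg hbx (sub_nonneg.2 h2)
      have f3 := mul_nonneg (sub_nonneg.2 h1) hvx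
      have f4 := mul_nonneg (sub_nonneg.2 h1) hvy
      constructor <;> linarith
  have H4 : (bY + bx) * |vy - vx| ≤ 2 * (δ * Sg) := by
    rcases Hs with ⟨h1, h2, h3⟩ | ⟨h1, h2, h3⟩
    · rw [hδ, abs_of_nonneg (by linarith : 0 ≤ wy - wx), abs_of_nonneg (by linarith : 0 ≤ vy - vx)]
      have e : (wy - wx) * Sg = bY * vy - bx * vx := by rw [hx, hy, hSg]; ring
      rw [e]
      have f3 := mul_nonneg (sub_nonneg.2 h1) hvx
      have f4 := mul_nonneg (sub_nonneg.2 h1) hvy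
      linarith
    · rw [hδ, abs_of_nonpos (by linarith : wy - wx ≤ 0), abs_of_nonpos (by linarith : vy - vx ≤ 0)]
      have e : -(wy - wx) * Sg = bx * vx - bY * vy := by rw [hx, hy, hSg]; ring
      rw [e]
      have f3 := mul_nonneg (sub_nonneg.2 h1) hvx
      have f4 := mul_nonneg (sub_nonneg.2 h1) hvy
      linarith
  set A := (ηx ^ 2 + ηy ^ 2) / 2 with hA
  set D := (ηy ^ 2 - ηx ^ 2) / 2 with hD
  set l := |ηy - ηx| with hl
  have hl0 : 0 ≤ l := abs_nonneg _
  have hl2 : l ^ 2 = (ηy - ηx) ^ 2 := sq_abs _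
  have hA0 : 0 ≤ A := by positivity
  have hηx2 : ηx ^ 2 ≤ 1 := pow_le_one₀ hηx hηx1
  have hηy2 : ηy ^ 2 ≤ 1 := pow_le_one₀ hηy hηy1
  have hA1 : A ≤ 1 := by rw [hA]; linarith
  have hDl : |D| = l * ((ηx + ηy) / 2) := by
    rw [hD, hl, ← abs_of_nonneg (by positivity : 0 ≤ (ηx + ηy) / 2), ← abs_mul]; congr 1
    ring
  have hDl' : |D| ≤ l := by rw [hDl]; linarith [mul_nonneg hl0 (by linarith : 0 ≤ 1 - (ηx + ηy) / 2)]
  have hηA : (ηx + ηy) ^ 2 ≤ 4 * A := by rw [hA]; linarith [sq_nonneg (ηx - ηy)]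
  have hT : (ηy ^ 2 * bY - ηx ^ 2 * bx) * (vy - vx) - ηy ^ 2 * bY * vx * (S + g / 2)
        - ηx ^ 2 * bx * vy * (-S + g / 2) = A * ((bY - bx) * (vy - vx)) + D * ((bY + bx) * (vy - vx))
        - g / 2 * (ηy ^ 2 * P + ηx ^ 2 * Q) - S * (A * (P - Q) + D * (P + Q)) := by
    rw [hA, hD, hP, hQ]; ring
  rw [hT]
  have b1 : ηy ^ 2 * P + ηx ^ 2 * Q ≤ w2 := by linarith [mul_nonneg (sub_nonneg.2 hηx2) hQ0, mul_nonneg (sub_nonneg.2 hηy2) hP0]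
  have b1' : g / 2 * (ηy ^ 2 * P + ηx ^ 2 * Q) ≤ g / 2 * w2 := by gcongr
  have b2 : |A * (P - Q) + D * (P + Q)| ≤ w2 := by
    have e : A * (P - Q) + D * (P + Q) = ηy ^ 2 * P - ηx ^ 2 * Q := by rw [hA, hD]; ring
    rw [e, abs_le]; constructor <;> linarith [mul_nonneg (sub_nonneg.2 hηx2) hQ0, mul_nonneg (sub_nonneg.2 hηy2) hP0, mul_nonneg (sq_nonneg ηy) hP0, mul_nonneg (sq_nonneg ηx) hQ0]
  have b3 : |A * (P - Q) + D * (P + Q)| ≤ A * (δ * Sg) + l * w2 := by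
    refine (abs_add_le _ _).trans ?_
    rw [abs_mul, abs_mul, abs_of_nonneg hA0, abs_of_nonneg (by positivity : 0 ≤ P + Q)]
    gcongr
  have hα0 : 0 < α := by linarith
  have b4 : S * (A * (P - Q) + D * (P + Q)) ≤ k * (A * (δ * Sg) + l * w2) + g / 2 * w2 := by
    calc S * (A * (P - Q) + D * (P + Q)) ≤ |S| * |A * (P - Q) + D * (P + Q)| := by
          rw [← abs_mul]; exact le_abs_self _
      _ ≤ (k + g / 2) * |A * (P - Q) + D * (P + Q)| := by gcongr
      _ ≤ _ := by rw [add_mul]; gcongr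
  have b5 : α * (k * (A * (δ * Sg))) ≤ A * δ ^ 2 / 4 + 2 * α ^ 2 * g * w2 := by
    have : A * (α * k * δ * Sg) ≤ A * (δ ^ 2 / 4 + α ^ 2 * k ^ 2 * Sg ^ 2) := by
      gcongr; linarith [sq_nonneg (δ / 2 - α * k * Sg)]
    have h2 : A * (α ^ 2 * k ^ 2 * Sg ^ 2) ≤ 1 * (α ^ 2 * k ^ 2 * (2 * w2)) := by gcongr
    rw [hkg] at h2 this; linarith
  have b6 : k * (l * w2) ≤ (g + l ^ 2) / 2 * w2 := by
    rw [← hkg]; linarith [mul_nonneg hw20 (sq_nonneg (k - l))]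
  have b7 : -(D * ((bY + bx) * (vy - vx))) ≤ l * (ηx + ηy) * (δ * Sg) := by
    calc -(D * ((bY + bx) * (vy - vx))) ≤ |D * ((bY + bx) * (vy - vx))| := neg_le_abs _
      _ = |D| * ((bY + bx) * |vy - vx|) := by
        rw [abs_mul, abs_mul, abs_of_nonneg (by positivity : 0 ≤ bY + bx)]
      _ ≤ |D| * (2 * (δ * Sg)) := by gcongr
      _ = _ := by rw [hDl]; ring
  have b8 : α * (l * (ηx + ηy) * (δ * Sg)) ≤ A * δ ^ 2 / 4 + 8 * α ^ 2 * l ^ 2 * w2 := by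
    have h1 : α * (l * (ηx + ηy) * (δ * Sg)) ≤ ((ηx + ηy) * δ) ^ 2 / 16 + 4 * (α * l * Sg) ^ 2 := by
      linarith [sq_nonneg ((ηx + ηy) * δ / 4 - 2 * (α * l * Sg)), mul_nonneg (mul_nonneg hα0.le (mul_nonneg hl0 (add_nonneg hηx hηy))) (mul_nonneg hδ0 hSg0)]
    have h2 : ((ηx + ηy) * δ) ^ 2 ≤ 4 * A * δ ^ 2 := by rw [mul_pow]; gcongr
    have h3 : (α * l * Sg) ^ 2 ≤ α ^ 2 * l ^ 2 * (2 * w2) := by rw [mul_pow, mul_pow]; gcongr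
    linarith
  have b9 : A * δ ^ 2 ≤ α * (A * ((bY - bx) * (vy - vx))) := by
    rw [hδ2]; linarith [mul_le_mul_of_nonneg_left H2 hA0]
  have b10 : (ηy * wy - ηx * wx) ^ 2 ≤ 2 * (A * δ ^ 2) + l ^ 2 * w2 := by
    have e : ηy * wy - ηx * wx = (ηx + ηy) / 2 * (wy - wx) + (ηy - ηx) * Sg / 2 := by rw [hSg]; ring
    have h1 : (ηy * wy - ηx * wx) ^ 2 ≤ (ηx + ηy) ^ 2 / 2 * δ ^ 2 + l ^ 2 * Sg ^ 2 / 2 := by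
      rw [e, hδ2, hl2]
      linarith [sq_nonneg ((ηx + ηy) / 2 * (wy - wx) - (ηy - ηx) * Sg / 2)]
    have h2 : (ηx + ηy) ^ 2 / 2 * δ ^ 2 ≤ (4 * A) / 2 * δ ^ 2 := by gcongr
    have h3 : l ^ 2 * Sg ^ 2 / 2 ≤ l ^ 2 * (2 * w2) / 2 := by gcongr
    linarith
  rw [← hl2]
  have hPOW : ∀ t : ℝ, 0 ≤ t → t ≤ α ^ 2 * t := fun t ht => le_mul_of_one_le_left ht (one_le_pow₀ hα)
  have hPOW1 : ∀ t : ℝ, 0 ≤ t → α * t ≤ α ^ 2 * t := fun t ht => by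
    gcongr; exact le_self_pow₀ hα two_ne_zero
  have c1 : α * (g * w2) ≤ α ^ 2 * (g * w2) := by
    have : 0 ≤ g * w2 := by positivity
    exact hPOW1 _ this
  have c2 : α * (l ^ 2 * w2) ≤ α ^ 2 * (l ^ 2 * w2) := by
    have : 0 ≤ l ^ 2 * w2 := by positivity
    exact hPOW1 _ this
  have c3 : l ^ 2 * w2 ≤ α ^ 2 * (l ^ 2 * w2) := by
    have : 0 ≤ l ^ 2 * w2 := by positivity
    exact hPOW _ this
  have b4' := mul_le_mul_of_nonneg_left b4 hα0.le
  have b1'' := mul_le_mul_of_nonneg_left b1' hα0.le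
  have b6' := mul_le_mul_of_nonneg_left b6 hα0.le
  have b7' := mul_le_mul_of_nonneg_left b7 hα0.le
  have p1 : 0 ≤ α ^ 2 * (g * w2) := by positivity
  have p2 : 0 ≤ α ^ 2 * (l ^ 2 * w2) := by positivity
  linarith

lemma edge_ineq {α φx φy ux uy ηx ηy : ℝ} (hα : 1 ≤ α) (hφx : 0 < φx) (hφy : 0 < φy)
    (hux : 0 ≤ ux) (huy : 0 ≤ uy)
    (hηx : 0 ≤ ηx) (hηx1 : ηx ≤ 1) (hηy : 0 ≤ ηy) (hηy1 : ηy ≤ 1) :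
    (ηy * (φy * uy) ^ α - ηx * (φx * ux) ^ α) ^ 2 ≤
      4 * α * ((ηy ^ 2 * φy * (φy * uy) ^ (2 * α - 1) - ηx ^ 2 * φx * (φx * ux) ^ (2 * α - 1))
        * (uy - ux)) +
      37 * α ^ 2 * (((φy - φx) ^ 2 / (φx * φy) + (ηy - ηx) ^ 2) *
        (((φx * ux) ^ α) ^ 2 + ((φy * uy) ^ α) ^ 2)) := by
  set vx := φx * ux with hvx
  set vy := φy * uy with hvy
  have hvx0 : 0 ≤ vx := by positivity
  have hvy0 : 0 ≤ vy := by positivity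
  have key : ∀ z : ℝ, 0 ≤ z → z ^ (2 * α - 1) * z = (z ^ α) ^ 2 := by
    intro z hz
    rw [← Real.rpow_natCast, ← Real.rpow_mul hz]
    nth_rw 2 [← Real.rpow_one z]
    rw [← Real.rpow_add_of_nonneg hz (by linarith) (by linarith)]; congr 1; push_cast; ring
  have := edge_alg (α := α) (vx := vx) (vy := vy) (bx := vx ^ (2 * α - 1)) (bY := vy ^ (2 * α - 1))
    (wx := vx ^ α) (wy := vy ^ α) (ηx := ηx) (ηy := ηy) (S := (φy / φx - φx / φy) / 2)
    (g := (φy - φx) ^ 2 / (φx * φy)) hα hvx0 hvy0 (by positivity) (by positivity)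
    (by positivity) (by positivity) (key _ hvx0) (key _ hvy0) ?_ ?_ hηx hηx1 hηy hηy1
    (by positivity) ?_
  · refine this.trans (le_of_eq ?_)
    congr 2
    rw [hvx, hvy]
    generalize (φx * ux) ^ (2 * α - 1) = bx
    generalize (φy * uy) ^ (2 * α - 1) = bY
    field_simp
    ring
  · rcases le_total vx vy with h | h
    · exact pow_facts hα hvx0 h
    · have := pow_facts hα hvy0 h
      linarith
  · rcases le_total vx vy with h | h
    · left
      exact ⟨Real.rpow_le_rpow hvx0 h (by linarith), h, Real.rpow_le_rpow hvx0 h (by linarith)⟩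
    · right
      exact ⟨Real.rpow_le_rpow hvy0 h (by linarith), h, Real.rpow_le_rpow hvy0 h (by linarith)⟩
  · field_simp
    ring

lemma cacc {ι : Type*} (B : Finset ι) (c : ι → ι → ℝ) (hsym : ∀ x y, c x y = c y x)
    (hc : ∀ x y, 0 ≤ c x y) (η u φ : ι → ℝ) (hη0 : ∀ x, 0 ≤ η x) (hη1 : ∀ x, η x ≤ 1)
    (hu : ∀ x, 0 ≤ u x) (hφ : ∀ x, 0 < φ x) (α : ℝ) (hα : 1 ≤ α)
    (hL : ∀ x ∈ B, η x ≠ 0 → 0 ≤ ∑ y ∈ B, c x y * (u y - u x)) :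
    ∑ x ∈ B, ∑ y ∈ B, c x y * (η y * (φ y * u y) ^ α - η x * (φ x * u x) ^ α) ^ 2 ≤
      37 * α ^ 2 * ∑ x ∈ B, ∑ y ∈ B, c x y * (((φ y - φ x) ^ 2 / (φ x * φ y) + (η y - η x) ^ 2) *
        (((φ x * u x) ^ α) ^ 2 + ((φ y * u y) ^ α) ^ 2)) := by
  set ψ : ι → ℝ := fun x => η x ^ 2 * φ x * (φ x * u x) ^ (2 * α - 1) with hψ
  have hψ0 : ∀ x, 0 ≤ ψ x := fun x => by
    have := hφ x
    have := hu x
    simp only [hψ]; positivity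
  have hT : ∑ x ∈ B, ∑ y ∈ B, c x y * ((ψ y - ψ x) * (u y - u x)) ≤ 0 := by
    have e1 : ∑ x ∈ B, ∑ y ∈ B, c x y * ((ψ y - ψ x) * (u y - u x)) =
        ∑ x ∈ B, ∑ y ∈ B, c x y * (ψ y * (u y - u x)) -
        ∑ x ∈ B, ∑ y ∈ B, c x y * (ψ x * (u y - u x)) := by
      simp only [← Finset.sum_sub_distrib]
      refine Finset.sum_congr rfl fun x _ => Finset.sum_congr rfl fun y _ => by ring
    have e2 : ∑ x ∈ B, ∑ y ∈ B, c x y * (ψ y * (u y - u x)) =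
        - ∑ x ∈ B, ∑ y ∈ B, c x y * (ψ x * (u y - u x)) := by
      rw [Finset.sum_comm]
      simp only [← Finset.sum_neg_distrib]
      refine Finset.sum_congr rfl fun x _ => Finset.sum_congr rfl fun y _ => by
        rw [hsym y x]; ring
    have e3 : 0 ≤ ∑ x ∈ B, ∑ y ∈ B, c x y * (ψ x * (u y - u x)) := by
      refine Finset.sum_nonneg fun x hx => ?_
      have : ∑ y ∈ B, c x y * (ψ x * (u y - u x)) = ψ x * ∑ y ∈ B, c x y * (u y - u x) := by
        rw [Finset.mul_sum]
        refine Finset.sum_congr rfl fun y _ => by ring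
      rw [this]
      by_cases h : η x = 0
      · simp [hψ, h]
      · exact mul_nonneg (hψ0 x) (hL x hx h)
    rw [e1, e2]; linarith
  have hS : ∑ x ∈ B, ∑ y ∈ B, c x y * (η y * (φ y * u y) ^ α - η x * (φ x * u x) ^ α) ^ 2 ≤
      ∑ x ∈ B, ∑ y ∈ B, (4 * α * (c x y * ((ψ y - ψ x) * (u y - u x))) + 37 * α ^ 2 * 
        (c x y * (((φ y - φ x) ^ 2 / (φ x * φ y) + (η y - η x) ^ 2) *
        (((φ x * u x) ^ α) ^ 2 + ((φ y * u y) ^ α) ^ 2)))) := by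
    refine Finset.sum_le_sum fun x _ => Finset.sum_le_sum fun y _ => ?_
    have := mul_le_mul_of_nonneg_left (edge_ineq hα (hφ x) (hφ y) (hu x) (hu y) (hη0 x) (hη1 x)
      (hη0 y) (hη1 y)) (hc x y)
    refine this.trans (le_of_eq ?_)
    simp only [hψ]; ring
  simp only [Finset.sum_add_distrib, ← Finset.mul_sum] at hS
  have : 4 * α * ∑ x ∈ B, ∑ y ∈ B, c x y * ((ψ y - ψ x) * (u y - u x)) ≤ 0 :=
    mul_nonpos_of_nonneg_of_nonpos (by linarith) hT
  linarith

lemma cacc2 {ι : Type*} (B : Finset ι) (c : ι → ι → ℝ) (hsym : ∀ x y, c x y = c y x)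
    (hc : ∀ x y, 0 ≤ c x y) (η u φ G M : ι → ℝ) (Λ : ℝ) (hη0 : ∀ x, 0 ≤ η x) (hη1 : ∀ x, η x ≤ 1)
    (hu : ∀ x, 0 ≤ u x) (hφ : ∀ x, 0 < φ x) (α : ℝ) (hα : 1 ≤ α)
    (hL : ∀ x ∈ B, η x ≠ 0 → 0 ≤ ∑ y ∈ B, c x y * (u y - u x))
    (hG : ∀ x ∈ B, ∑ y ∈ B, c x y * ((φ y - φ x) ^ 2 / (φ x * φ y)) ≤ G x)
    (hM : ∀ x ∈ B, ∑ y ∈ B, c x y ≤ M x) (hΛ0 : 0 ≤ Λ)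
    (hΛ : ∀ x ∈ B, ∀ y ∈ B, 0 < c x y → (η y - η x) ^ 2 ≤ Λ) :
    ∑ x ∈ B, ∑ y ∈ B, c x y * (η y * (φ y * u y) ^ α - η x * (φ x * u x) ^ α) ^ 2 ≤
      74 * α ^ 2 * ∑ x ∈ B, (((φ x * u x) ^ α) ^ 2 * (G x + Λ * M x)) := by
  refine (cacc B c hsym hc η u φ hη0 hη1 hu hφ α hα hL).trans ?_
  set w : ι → ℝ := fun x => ((φ x * u x) ^ α) ^ 2 with hw
  set k : ι → ι → ℝ := fun x y => c x y * ((φ y - φ x) ^ 2 / (φ x * φ y) + (η y - η x) ^ 2) with hk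
  have ksym : ∀ x y, k x y = k y x := fun x y => by
    simp only [hk]; rw [hsym x y, mul_comm (φ x)]; ring
  have e1 : ∑ x ∈ B, ∑ y ∈ B, c x y * (((φ y - φ x) ^ 2 / (φ x * φ y) + (η y - η x) ^ 2) *
        (((φ x * u x) ^ α) ^ 2 + ((φ y * u y) ^ α) ^ 2)) = 2 * ∑ x ∈ B, ∑ y ∈ B, k x y * w x := by
    have e : ∑ x ∈ B, ∑ y ∈ B, k x y * w y = ∑ x ∈ B, ∑ y ∈ B, k x y * w x := by
      rw [Finset.sum_comm]
      refine Finset.sum_congr rfl fun x _ => Finset.sum_congr rfl fun y _ => by rw [ksym]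
    rw [two_mul]
    nth_rw 2 [← e]
    simp only [← Finset.sum_add_distrib]
    refine Finset.sum_congr rfl fun x _ => Finset.sum_congr rfl fun y _ => by
      simp only [hk, hw]; ring
  rw [e1]
  have e2 : ∑ x ∈ B, ∑ y ∈ B, k x y * w x ≤ ∑ x ∈ B, w x * (G x + Λ * M x) := by
    refine Finset.sum_le_sum fun x hx => ?_
    rw [← Finset.sum_mul, mul_comm]
    have hw0 : 0 ≤ w x := sq_nonneg _
    refine mul_le_mul_of_nonneg_left ?_ hw0
    calc ∑ y ∈ B, k x y ≤ ∑ y ∈ B, (c x y * ((φ y - φ x) ^ 2 / (φ x * φ y)) + Λ * c x y) := by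
          refine Finset.sum_le_sum fun y hy => ?_
          simp only [hk]
          rw [mul_add]
          rcases eq_or_lt_of_le (hc x y) with h | h
          · rw [← h]; simp
          · have := mul_le_mul_of_nonneg_left (hΛ x hx y hy h) h.le
            linarith
      _ = _ := by rw [Finset.sum_add_distrib, ← Finset.mul_sum]
      _ ≤ _ := add_le_add (hG x hx) (mul_le_mul_of_nonneg_left (hM x hx) hΛ0)
  have : (0:ℝ) ≤ 74 * α ^ 2 := by positivity
  have := mul_le_mul_of_nonneg_left e2 this
  linarith

lemma holder_avg {ι : Type*} (B : Finset ι) (f g : ι → ℝ) (hf : ∀ x ∈ B, 0 ≤ f x)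
    (hg : ∀ x ∈ B, 0 ≤ g x) {p q : ℝ} (hpq : p.HolderConjugate q) {W : ℝ} (hW : 0 < W) :
    ∑ x ∈ B, f x * g x ≤ W * (((∑ x ∈ B, f x ^ p) / W) ^ (1 / p) *
      ((∑ x ∈ B, g x ^ q) / W) ^ (1 / q)) := by
  have h := Real.inner_le_Lp_mul_Lq_of_nonneg B hpq hf hg
  refine h.trans (le_of_eq ?_)
  have h1 : 0 ≤ ∑ x ∈ B, f x ^ p := Finset.sum_nonneg fun x hx => Real.rpow_nonneg (hf x hx) _
  have h2 : 0 ≤ ∑ x ∈ B, g x ^ q := Finset.sum_nonneg fun x hx => Real.rpow_nonneg (hg x hx) _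
  rw [Real.div_rpow h1 hW.le, Real.div_rpow h2 hW.le]
  have : W = W ^ (1 / p) * W ^ (1 / q) := by
    rw [← Real.rpow_add hW]
    have := hpq.inv_add_inv_eq_one
    rw [one_div, one_div, this, Real.rpow_one]
  have a1 : W ^ (1 / p) ≠ 0 := (Real.rpow_pos_of_pos hW _).ne'
  have a2 : W ^ (1 / q) ≠ 0 := (Real.rpow_pos_of_pos hW _).ne'
  nth_rw 1 [this]
  field_simp

/-- weighted Sobolev -/
lemma sobw {ι : Type*} (B : Finset ι) (c : ι → ι → ℝ) (hsym : ∀ x y, c x y = c y x)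
    (hc : ∀ x y, 0 ≤ c x y) (F N : ι → ℝ) (hF : ∀ x, 0 ≤ F x)
    (hN : ∀ x ∈ B, ∑ y ∈ B, (if 0 < c x y then (c x y)⁻¹ else 0) ≤ N x)
    {ζ r e q q' W K : ℝ} (hζ : 1 < ζ) (hr : 0 < r) (hq : q'.HolderConjugate q)
    (he1 : e = ζ * r) (he2 : e = 2 * (ζ - 1) * q') (hW : 0 < W) (hK : 0 ≤ K)
    (hsob : ((∑ x ∈ B, (F x ^ ζ) ^ r) / W) ^ (1 / r) ≤
      K / W * (1 / 2 * ∑ x ∈ B, ∑ y ∈ B, if 0 < c x y then |F y ^ ζ - F x ^ ζ| else 0)) :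
    ((∑ x ∈ B, F x ^ e) / W) ^ (2 / e) ≤
      (K * ζ) ^ 2 * ((∑ x ∈ B, N x ^ q) / W) ^ (1 / q) *
        ((∑ x ∈ B, ∑ y ∈ B, c x y * (F y - F x) ^ 2) / W) := by
  have hζ0 : 0 < ζ := by linarith
  have he : 0 < e := by rw [he1]; positivity
  set X := (∑ x ∈ B, F x ^ e) / W with hX
  set E := ∑ x ∈ B, ∑ y ∈ B, c x y * (F y - F x) ^ 2 with hE
  have hE0 : 0 ≤ E := Finset.sum_nonneg fun x _ => Finset.sum_nonneg fun y _ =>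
    mul_nonneg (hc x y) (sq_nonneg _)
  have hN0 : ∀ x ∈ B, 0 ≤ N x := fun x hx => (Finset.sum_nonneg fun y _ => by
    split_ifs with h
    · exact (inv_pos.2 h).le
    · exact le_rfl).trans (hN x hx)
  set Mq := ((∑ x ∈ B, N x ^ q) / W) ^ (1 / q) with hMq
  have hMq0 : 0 ≤ Mq := Real.rpow_nonneg (div_nonneg (Finset.sum_nonneg fun x hx =>
    Real.rpow_nonneg (hN0 x hx) _) hW.le) _
  have hX0 : 0 ≤ X := div_nonneg (Finset.sum_nonneg fun x hx =>
    Real.rpow_nonneg (hF x) _) hW.le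
  have hX1 : (∑ x ∈ B, (F x ^ ζ) ^ r) / W = X := by
    rw [hX]; congr 1
    refine Finset.sum_congr rfl fun x _ => by rw [← Real.rpow_mul (hF x), he1]
  rw [hX1] at hsob
  set Y := ∑ x ∈ B, ∑ y ∈ B, if 0 < c x y then |F y - F x| * (F x ^ (ζ - 1) + F y ^ (ζ - 1)) else 0
    with hY
  have hY0 : 0 ≤ Y := Finset.sum_nonneg fun x _ => Finset.sum_nonneg fun y _ => by
    have := Real.rpow_nonneg (hF x) (ζ - 1)
    have := Real.rpow_nonneg (hF y) (ζ - 1)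
    split_ifs <;> positivity
  have h1 : ∑ x ∈ B, ∑ y ∈ B, (if 0 < c x y then |F y ^ ζ - F x ^ ζ| else 0) ≤ ζ * Y := by
    rw [hY, Finset.mul_sum]
    refine Finset.sum_le_sum fun x _ => ?_
    rw [Finset.mul_sum]
    refine Finset.sum_le_sum fun y _ => ?_
    split_ifs
    · exact abs_rpow_sub_le hζ.le (hF x) (hF y)
    · simp
  set Z := ∑ x ∈ B, ∑ y ∈ B, (if 0 < c x y then (c x y)⁻¹ else 0) * (F x ^ (ζ - 1) + F y ^ (ζ - 1)) ^ 2
    with hZ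
  have h2 : Y ^ 2 ≤ E * Z := by
    rw [hY, hE, hZ]
    simp only [← Finset.sum_product']
    refine Finset.sum_sq_le_sum_mul_sum_of_sq_le_mul _ ?_ ?_ ?_
    · intro i _; exact mul_nonneg (hc _ _) (sq_nonneg _)
    · intro i _
      refine mul_nonneg ?_ (sq_nonneg _)
      split_ifs with h
      · exact (inv_pos.2 h).le
      · exact le_rfl
    · intro i _
      apply le_of_eq
      split_ifs with h
      · rw [mul_pow, sq_abs]; field_simp
      · simp
  have h3 : Z ≤ 4 * ∑ x ∈ B, F x ^ (2 * (ζ - 1)) * N x := by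
    set k : ι → ι → ℝ := fun x y => if 0 < c x y then (c x y)⁻¹ else 0 with hk
    have hk0 : ∀ x y, 0 ≤ k x y := fun x y => by
      simp only [hk]; split_ifs with h
      · exact (inv_pos.2 h).le
      · exact le_rfl
    have ksym : ∀ x y, k x y = k y x := fun x y => by simp only [hk]; rw [hsym]
    have hsq : ∀ x, (F x ^ (ζ - 1)) ^ 2 = F x ^ (2 * (ζ - 1)) := fun x => by
      rw [← Real.rpow_natCast, ← Real.rpow_mul (hF x)]; congr 1; push_cast; ring
    calc Z ≤ ∑ x ∈ B, ∑ y ∈ B, (2 * (k x y * F x ^ (2 * (ζ - 1))) + 2 * (k x y * F y ^ (2 * (ζ - 1)))) := by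
          refine Finset.sum_le_sum fun x _ => Finset.sum_le_sum fun y _ => ?_
          rw [← hsq, ← hsq]
          have : (F x ^ (ζ - 1) + F y ^ (ζ - 1)) ^ 2 ≤ 2 * (F x ^ (ζ - 1)) ^ 2 + 2 * (F y ^ (ζ - 1)) ^ 2 := by
            nlinarith [sq_nonneg (F x ^ (ζ - 1) - F y ^ (ζ - 1))]
          have := mul_le_mul_of_nonneg_left this (hk0 x y)
          linarith
      _ = 4 * ∑ x ∈ B, ∑ y ∈ B, k x y * F x ^ (2 * (ζ - 1)) := by
          have e : ∑ x ∈ B, ∑ y ∈ B, k x y * F y ^ (2 * (ζ - 1)) = ∑ x ∈ B, ∑ y ∈ B, k x y * F x ^ (2 * (ζ - 1)) := by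
            rw [Finset.sum_comm]
            refine Finset.sum_congr rfl fun x _ => Finset.sum_congr rfl fun y _ => by rw [ksym]
          simp only [Finset.sum_add_distrib, ← Finset.mul_sum]
          rw [e]; ring
      _ ≤ _ := by
          gcongr with x hx
          rw [← Finset.sum_mul, mul_comm]
          exact mul_le_mul_of_nonneg_left (hN x hx) (Real.rpow_nonneg (hF x) _)
  have h4 : ∑ x ∈ B, F x ^ (2 * (ζ - 1)) * N x ≤ W * (X ^ (1 / q') * Mq) := by
    have := holder_avg B (fun x => F x ^ (2 * (ζ - 1))) N (fun x _ => Real.rpow_nonneg (hF x) _) hN0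
      hq hW
    refine this.trans (le_of_eq ?_)
    rw [hX, hMq]
    congr 4
    refine Finset.sum_congr rfl fun x _ => by rw [← Real.rpow_mul (hF x), he2]
  have h5 : X ^ (1 / r) ≤ K / W * (1 / 2 * (ζ * Y)) := hsob.trans (by gcongr)
  have h6 : (X ^ (1 / r)) ^ 2 ≤ (K * ζ) ^ 2 * Mq * (E / W) * X ^ (1 / q') := by
    calc (X ^ (1 / r)) ^ 2 ≤ (K / W * (1 / 2 * (ζ * Y))) ^ 2 := by
          have := Real.rpow_nonneg hX0 (1 / r)
          gcongr
      _ = (K * ζ) ^ 2 / (4 * W ^ 2) * Y ^ 2 := by field_simp; norm_num; ring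
      _ ≤ (K * ζ) ^ 2 / (4 * W ^ 2) * (E * (4 * (W * (X ^ (1 / q') * Mq)))) := by
          gcongr
          exact h2.trans (mul_le_mul_of_nonneg_left (h3.trans (by linarith)) hE0)
      _ = _ := by field_simp
  rcases eq_or_lt_of_le hX0 with h | h
  · rw [← h, Real.zero_rpow (by positivity)]; positivity
  · have hp : 0 < X ^ (1 / q') := Real.rpow_pos_of_pos h _
    have : (X ^ (1 / r)) ^ 2 = X ^ (2 / e) * X ^ (1 / q') := by
      rw [← Real.rpow_natCast, ← Real.rpow_mul h.le, ← Real.rpow_add h]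
      congr 1
      have hq' : q' ≠ 0 := hq.ne_zero
      have : 1 / r = ζ / e := by rw [he1]; field_simp
      rw [this]
      have : 1 / q' = 2 * (ζ - 1) / e := by
        have : ζ - 1 ≠ 0 := by linarith
        rw [he2]; field_simp
      rw [this]; push_cast; field_simp; ring
    rw [this] at h6
    exact le_of_mul_le_mul_right h6 hp

/-- normalised weighted norm -/
noncomputable def wn {ι : Type*} (v : ι → ℝ) (W : ℝ) (B : Finset ι) (β : ℝ) : ℝ :=
  ((∑ x ∈ B, v x ^ β) / W) ^ (1 / β)

lemma wsum_nonneg {ι : Type*} {v : ι → ℝ} (hv : ∀ x, 0 ≤ v x) {W : ℝ} (hW : 0 < W) (B : Finset ι) (β : ℝ) :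
    0 ≤ (∑ x ∈ B, v x ^ β) / W :=
  div_nonneg (Finset.sum_nonneg fun x _ => Real.rpow_nonneg (hv x) _) hW.le

lemma wn_nonneg {ι : Type*} {v : ι → ℝ} (hv : ∀ x, 0 ≤ v x) {W : ℝ} (hW : 0 < W) (B : Finset ι) (β : ℝ) :
    0 ≤ wn v W B β := Real.rpow_nonneg (wsum_nonneg hv hW B β) _

lemma wn_mono {ι : Type*} {v : ι → ℝ} (hv : ∀ x, 0 ≤ v x) {W : ℝ} (hW : 0 < W) {A B : Finset ι} (h : A ⊆ B)
    {β : ℝ} (hβ : 0 < β) : wn v W A β ≤ wn v W B β := by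
  unfold wn
  refine Real.rpow_le_rpow (wsum_nonneg hv hW A β) ?_ (by positivity)
  gcongr
  intro x _ _
  exact Real.rpow_nonneg (hv x) _

lemma wn_rpow {ι : Type*} {v : ι → ℝ} (hv : ∀ x, 0 ≤ v x) {W : ℝ} (hW : 0 < W) (B : Finset ι) {β : ℝ} (hβ : 0 < β) :
    wn v W B β ^ β = (∑ x ∈ B, v x ^ β) / W := by
  unfold wn
  rw [← Real.rpow_mul (wsum_nonneg hv hW B β), one_div_mul_cancel hβ.ne', Real.rpow_one]

lemma le_wn {ι : Type*} {v : ι → ℝ} (hv : ∀ x, 0 ≤ v x) {W : ℝ} (hW : 0 < W) (B : Finset ι) {β : ℝ} (hβ : 0 < β)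
    {x : ι} (hx : x ∈ B) : v x ≤ W ^ (1 / β) * wn v W B β := by
  unfold wn
  rw [← Real.mul_rpow hW.le (wsum_nonneg hv hW B β), mul_div_cancel₀ _ hW.ne']
  have h1 : v x ^ β ≤ ∑ x ∈ B, v x ^ β :=
    Finset.single_le_sum (f := fun x => v x ^ β) (fun y _ => Real.rpow_nonneg (hv y) _) hx
  calc v x = (v x ^ β) ^ (1 / β) := by
        rw [← Real.rpow_mul (hv x), mul_one_div_cancel hβ.ne', Real.rpow_one]
    _ ≤ _ := Real.rpow_le_rpow (Real.rpow_nonneg (hv x) _) h1 (by positivity)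

lemma wn_jensen {ι : Type*} {v : ι → ℝ} (hv : ∀ x, 0 ≤ v x) {W : ℝ} (hW : 0 < W) (B : Finset ι)
    (hB : (B.card : ℝ) ≤ W) {β β' : ℝ} (hβ : 0 < β) (h : β ≤ β') : wn v W B β ≤ wn v W B β' := by
  rcases eq_or_lt_of_le h with h | h
  · rw [h]
  have hβ' : 0 < β' := hβ.trans h
  have hc : (β' / β).HolderConjugate (Real.conjExponent (β' / β)) :=
    Real.HolderConjugate.conjExponent ((one_lt_div hβ).2 h)
  have := holder_avg B (fun x => v x ^ β) (fun _ => 1) (fun x _ => Real.rpow_nonneg (hv x) _)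
    (fun _ _ => zero_le_one) hc hW
  simp only [mul_one, Real.one_rpow, Finset.sum_const, nsmul_eq_mul] at this
  have e : ∀ x, (v x ^ β) ^ (β' / β) = v x ^ β' := fun x => by
    rw [← Real.rpow_mul (hv x)]; congr 1; field_simp
  simp only [e] at this
  have h1 : ((B.card : ℝ) / W) ^ (1 / Real.conjExponent (β' / β)) ≤ 1 :=
    Real.rpow_le_one (by positivity) ((div_le_one hW).2 hB) (by
      have := hc.symm.pos
      positivity)
  have h0 := wsum_nonneg hv hW B β'
  have h2 : (∑ x ∈ B, v x ^ β) / W ≤ ((∑ x ∈ B, v x ^ β') / W) ^ (1 / (β' / β)) := by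
    rw [div_le_iff₀ hW, mul_comm]
    refine this.trans ?_
    gcongr
    exact mul_le_of_le_one_right (Real.rpow_nonneg h0 _) h1
  unfold wn
  calc _ ≤ (((∑ x ∈ B, v x ^ β') / W) ^ (1 / (β' / β))) ^ (1 / β) :=
        Real.rpow_le_rpow (wsum_nonneg hv hW B β) h2 (by positivity)
    _ = _ := by rw [← Real.rpow_mul h0]; congr 1; field_simp

lemma wn_const_le {ι : Type*} {v : ι → ℝ} (hv : ∀ x, 0 ≤ v x) {W W' : ℝ} (hW : 0 < W') (h : W' ≤ W) (B : Finset ι)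
    {β : ℝ} (hβ : 0 < β) : wn v W B β ≤ wn v W' B β := by
  unfold wn
  refine Real.rpow_le_rpow (wsum_nonneg hv (hW.trans_le h) B β) ?_ (by positivity)
  have : 0 ≤ ∑ x ∈ B, v x ^ β := Finset.sum_nonneg fun x _ => Real.rpow_nonneg (hv x) _
  gcongr

lemma moser {ι : Type*} (v : ι → ℝ) (hv : ∀ x, 0 ≤ v x) (S : ℝ → Finset ι)
    (hmono : ∀ s t, s ≤ t → S s ⊆ S t) {W P ρ A : ℝ} (hW : 0 < W) (hP : 0 < P) (hρ : 1 < ρ)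
    (hA : 1 ≤ A) (d : ℕ)
    (step : ∀ s t α : ℝ, 1 / 2 ≤ s → s < t → t ≤ 1 → 1 ≤ α →
      wn v W (S s) (ρ * (α * P)) ≤ (A * α ^ 2 * ((t - s)⁻¹) ^ d) ^ (1 / (2 * α)) *
        wn v W (S t) (α * P)) (s t : ℝ) (hs : 1 / 2 ≤ s) (hst : s < t) (ht : t ≤ 1)
    (x : ι) (hx : x ∈ S s) :
    v x ≤ ((A * 2 ^ d * ((t - s)⁻¹) ^ d) ^ (∑' j : ℕ, (1 / 2) * (ρ⁻¹) ^ j) *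
      (ρ ^ 2 * 2 ^ d) ^ (∑' j : ℕ, (1 / 2) * (j * (ρ⁻¹) ^ j))) * wn v W (S t) P := by
  have hρ0 : 0 < ρ := by linarith
  have hinv : ρ⁻¹ < 1 := inv_lt_one_of_one_lt₀ hρ
  have hinv0 : 0 < ρ⁻¹ := by positivity
  have sum0 : Summable fun j : ℕ => (1 / 2 : ℝ) * (ρ⁻¹) ^ j :=
    (summable_geometric_of_lt_one hinv0.le hinv).mul_left _
  have sum1 : Summable fun j : ℕ => (1 / 2 : ℝ) * (j * (ρ⁻¹) ^ j) := by
    have := summable_pow_mul_geometric_of_norm_lt_one (R := ℝ) 1 (r := ρ⁻¹) (by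
      rw [Real.norm_eq_abs, abs_of_pos hinv0]; exact hinv)
    simp only [pow_one] at this
    exact this.mul_left _
  set A' := A * 2 ^ d * ((t - s)⁻¹) ^ d with hA'
  set B' := ρ ^ 2 * 2 ^ d with hB'
  have hts : 0 < t - s := by linarith
  have hinvts : 1 ≤ (t - s)⁻¹ := (one_le_inv₀ hts).2 (by linarith)
  have hA'1 : 1 ≤ A' := by
    have h1 : (1:ℝ) ≤ 2 ^ d := one_le_pow₀ (by norm_num)
    have h2 : 1 ≤ ((t - s)⁻¹) ^ d := one_le_pow₀ hinvts
    exact one_le_mul_of_one_le_of_one_le (one_le_mul_of_one_le_of_one_le hA h1) h2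
  have hB'1 : 1 ≤ B' := by
    have h1 : (1:ℝ) ≤ 2 ^ d := one_le_pow₀ (by norm_num)
    exact one_le_mul_of_one_le_of_one_le (one_le_pow₀ hρ.le) h1
  set σ : ℕ → ℝ := fun k => s + (t - s) * (1 / 2) ^ k with hσ
  have hσgt : ∀ k, s < σ k := fun k => by simp only [hσ]; have : 0 < (t - s) * (1 / 2) ^ k := by positivity
                                          linarith
  have hσle : ∀ k, σ k ≤ t := fun k => by
    simp only [hσ]
    have : (t - s) * (1 / 2) ^ k ≤ (t - s) * 1 := by
      gcongr; exact pow_le_one₀ (by norm_num) (by norm_num)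
    linarith
  have hstep : ∀ k : ℕ, wn v W (S (σ k)) (ρ ^ k * P) ≤
      (A' ^ (∑ j ∈ Finset.range k, (1 / 2) * (ρ⁻¹) ^ j) *
      B' ^ (∑ j ∈ Finset.range k, (1 / 2) * (j * (ρ⁻¹) ^ j))) * wn v W (S t) P := by
    intro k
    induction k with
    | zero => simp [hσ]
    | succ k ih =>
      have hdiff : σ k - σ (k + 1) = (t - s) * (1 / 2) ^ (k + 1) := by
        simp only [hσ]; ring
      have hpos : 0 < (t - s) * (1 / 2 : ℝ) ^ (k + 1) := by positivity
      have h1 := step (σ (k + 1)) (σ k) (ρ ^ k) (hs.trans (hσgt _).le) (by linarith)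
        ((hσle k).trans ht) (one_le_pow₀ hρ.le)
      rw [hdiff] at h1
      have e1 : ρ * (ρ ^ k * P) = ρ ^ (k + 1) * P := by ring
      have e2 : A * (ρ ^ k) ^ 2 * (((t - s) * (1 / 2) ^ (k + 1))⁻¹) ^ d = A' * B' ^ k := by
        rw [hA', hB', mul_inv, mul_pow, mul_pow]
        have : ((1 / 2 : ℝ) ^ (k + 1))⁻¹ ^ d = 2 ^ d * (2 ^ d) ^ k := by
          have h2 : ((1 / 2 : ℝ) ^ (k + 1))⁻¹ = 2 ^ (k + 1) := by rw [← inv_pow]; norm_num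
          rw [h2, ← pow_mul, ← pow_mul, ← pow_add]; congr 1; ring
        rw [this, ← pow_mul, ← pow_mul]; ring
      rw [e1, e2] at h1
      have e3 : (A' * B' ^ k) ^ (1 / (2 * ρ ^ k)) =
          A' ^ ((1 / 2) * (ρ⁻¹) ^ k) * B' ^ ((1 / 2) * (k * (ρ⁻¹) ^ k)) := by
        rw [Real.mul_rpow (by linarith) (by positivity), ← Real.rpow_natCast B' k,
          ← Real.rpow_mul (by linarith)]
        congr 2
        · rw [inv_pow]; field_simp
        · rw [inv_pow]; field_simp
      rw [e3] at h1
      refine h1.trans ?_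
      rw [Finset.sum_range_succ, Finset.sum_range_succ, Real.rpow_add (by linarith),
        Real.rpow_add (by linarith)]
      have := mul_le_mul_of_nonneg_left ih (show 0 ≤ A' ^ ((1 / 2) * (ρ⁻¹) ^ k) * B' ^ ((1 / 2) * (k * (ρ⁻¹) ^ k)) by
        have := Real.rpow_nonneg (show 0 ≤ A' by linarith) ((1 / 2) * (ρ⁻¹) ^ k)
        positivity)
      refine this.trans (le_of_eq (by ring))
  have hNt := wn_nonneg hv hW (S t) P
  set Q := (A' ^ (∑' j : ℕ, (1 / 2) * (ρ⁻¹) ^ j) *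
      B' ^ (∑' j : ℕ, (1 / 2) * (j * (ρ⁻¹) ^ j))) * wn v W (S t) P with hQ
  have hbound : ∀ k : ℕ, v x ≤ W ^ (P⁻¹ * (ρ⁻¹) ^ k) * Q := by
    intro k
    have h1 := le_wn hv hW (S (σ k)) (show 0 < ρ ^ k * P by positivity) (hmono _ _ (hσgt k).le hx)
    have e : 1 / (ρ ^ k * P) = P⁻¹ * (ρ⁻¹) ^ k := by rw [inv_pow]; field_simp
    rw [e] at h1
    refine h1.trans ?_
    gcongr
    refine (hstep k).trans ?_
    rw [hQ]
    gcongr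
    · exact sum0.sum_le_tsum _ (fun j _ => by positivity)
    · exact sum1.sum_le_tsum _ (fun j _ => by positivity)
  have hlim : Tendsto (fun k : ℕ => W ^ (P⁻¹ * (ρ⁻¹) ^ k) * Q) atTop (𝓝 (W ^ (P⁻¹ * 0) * Q)) := by
    refine Tendsto.mul_const _ ?_
    refine (Real.continuous_const_rpow hW.ne').continuousAt.tendsto.comp ?_
    exact (tendsto_pow_atTop_nhds_zero_of_lt_one hinv0.le hinv).const_mul _
  have := ge_of_tendsto' hlim hbound
  simpa using this

lemma interp {ι : Type*} (v : ι → ℝ) (hv : ∀ x, 0 ≤ v x) (S : ℝ → Finset ι)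
    (hmono : ∀ s t, s ≤ t → S s ⊆ S t) {W P D k α : ℝ} (hW : 0 < W) (hα : 0 < α) (hαP : α ≤ P)
    (hD : 0 < D) (hk : 0 ≤ k)
    (H : ∀ s t : ℝ, 1 / 2 ≤ s → s < t → t ≤ 1 → ∀ x ∈ S s,
      v x ≤ D * ((t - s)⁻¹) ^ k * wn v W (S t) P) (s σ : ℝ) (hs : 1 / 2 ≤ s) (hsσ : s < σ)
    (hσ : σ ≤ 1) (x : ι) (hx : x ∈ S s) :
    v x ≤ (D * 2 ^ (k / (α / P))) ^ (1 / (α / P)) * ((σ - s)⁻¹) ^ (k / (α / P)) * wn v W (S σ) α := by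
  have hP : 0 < P := hα.trans_le hαP
  set θ := α / P with hθ
  have hθ0 : 0 < θ := by positivity
  have hθ1 : θ ≤ 1 := (div_le_one hP).2 hαP
  set N := wn v W (S σ) α with hN
  have hN0 : 0 ≤ N := wn_nonneg hv hW _ _
  set T : Set ℝ := {r | ∃ s x, 1 / 2 ≤ s ∧ s < σ ∧ x ∈ S s ∧ r = (σ - s) ^ (k / θ) * v x} with hT
  have hkθ : 0 ≤ k / θ := by positivity
  have hbdd : BddAbove T := by
    refine ⟨∑ y ∈ S σ, v y, ?_⟩
    rintro r ⟨s, x, h1, h2, h3, rfl⟩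
    have a1 : (σ - s) ^ (k / θ) ≤ 1 := Real.rpow_le_one (by linarith) (by linarith) hkθ
    have a2 : v x ≤ ∑ y ∈ S σ, v y :=
      Finset.single_le_sum (f := v) (fun y _ => hv y) (hmono _ _ h2.le h3)
    exact (mul_le_of_le_one_left (hv x) a1).trans a2
  set Φ := sSup T with hΦ
  have hΦ0 : 0 ≤ Φ := Real.sSup_nonneg (by
    rintro r ⟨s, x, h1, h2, h3, rfl⟩
    exact mul_nonneg (Real.rpow_nonneg (by linarith) _) (hv x))
  have hle : ∀ s x, 1 / 2 ≤ s → s < σ → x ∈ S s → (σ - s) ^ (k / θ) * v x ≤ Φ := fun s x h1 h2 h3 =>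
    le_csSup hbdd ⟨s, x, h1, h2, h3, rfl⟩
  have hmain : Φ ≤ D * 2 ^ (k / θ) * (Φ ^ (1 - θ) * N ^ θ) := by
    refine csSup_le ⟨_, s, x, hs, hsσ, hx, rfl⟩ ?_
    rintro r ⟨s, x, h1, h2, h3, rfl⟩
    set τ := σ - s with hτ
    have hτ0 : 0 < τ := by linarith
    set V := Φ * (2 / τ) ^ (k / θ) with hV
    have hV0 : 0 ≤ V := by positivity
    have hVy : ∀ y ∈ S (s + τ / 2), v y ≤ V := by
      intro y hy
      have := hle (s + τ / 2) y (by linarith) (by linarith) hy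
      have e : σ - (s + τ / 2) = τ / 2 := by linarith
      rw [e] at this
      have hpp : 0 < (τ / 2) ^ (k / θ) := Real.rpow_pos_of_pos (by positivity) _
      have e2 : (2 / τ) ^ (k / θ) = ((τ / 2) ^ (k / θ))⁻¹ := by
        rw [← Real.inv_rpow (by positivity), inv_div]
      rw [hV, e2, ← div_eq_mul_inv, le_div_iff₀ hpp]; linarith
    have hwn : wn v W (S (s + τ / 2)) P ≤ V ^ (1 - θ) * N ^ θ := by
      have b1 : (∑ y ∈ S (s + τ / 2), v y ^ P) / W ≤ V ^ (P - α) * N ^ α := by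
        rw [hN, wn_rpow hv hW _ hα, ← mul_div_assoc]
        gcongr
        rw [Finset.mul_sum]
        calc _ ≤ ∑ y ∈ S (s + τ / 2), V ^ (P - α) * v y ^ α := by
              refine Finset.sum_le_sum fun y hy => ?_
              have : v y ^ P = v y ^ (P - α) * v y ^ α := by
                rw [← Real.rpow_add_of_nonneg (hv y) (by linarith) hα.le]; congr 1; ring
              rw [this]
              have := Real.rpow_le_rpow (hv y) (hVy y hy) (show 0 ≤ P - α by linarith)
              exact mul_le_mul_of_nonneg_right this (Real.rpow_nonneg (hv y) _)
          _ ≤ _ := Finset.sum_le_sum_of_subset_of_nonneg (hmono _ _ (by linarith)) (fun y _ _ => by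
              have := Real.rpow_nonneg (hv y) α
              positivity)
      unfold wn
      refine (Real.rpow_le_rpow (wsum_nonneg hv hW _ P) b1 (by positivity)).trans (le_of_eq ?_)
      rw [Real.mul_rpow (by positivity) (by positivity), ← Real.rpow_mul hV0, ← Real.rpow_mul hN0]
      congr 2
      · rw [hθ]; field_simp
      · rw [hθ]; field_simp
    have h4 := H s (s + τ / 2) h1 (by linarith) (by linarith) x h3
    have e : (s + τ / 2 - s)⁻¹ = 2 / τ := by
      rw [add_sub_cancel_left, inv_div]
    rw [e] at h4
    have e5 : τ ^ (k / θ) * (D * (2 / τ) ^ k * (V ^ (1 - θ) * N ^ θ)) =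
        D * 2 ^ (k / θ) * (Φ ^ (1 - θ) * N ^ θ) := by
      have e6 : V ^ (1 - θ) = Φ ^ (1 - θ) * (2 / τ) ^ (k / θ * (1 - θ)) := by
        rw [hV, Real.mul_rpow hΦ0 (by positivity), ← Real.rpow_mul (by positivity)]
      have e7 : (2 / τ) ^ k * (2 / τ) ^ (k / θ * (1 - θ)) = (2 / τ) ^ (k / θ) := by
        rw [← Real.rpow_add (by positivity)]; congr 1; field_simp; ring
      have e8 : τ ^ (k / θ) * (2 / τ) ^ (k / θ) = 2 ^ (k / θ) := by
        rw [← Real.mul_rpow hτ0.le (by positivity)]; congr 1; field_simp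
      rw [e6, ← e8, ← e7]; ring
    rw [← e5]
    gcongr
    exact h4.trans (by gcongr)
  have hfin : Φ ≤ (D * 2 ^ (k / θ)) ^ (1 / θ) * N := by
    rcases eq_or_lt_of_le hΦ0 with h | h
    · rw [← h]; positivity
    · have hp : 0 < Φ ^ (1 - θ) := Real.rpow_pos_of_pos h _
      have e : Φ = Φ ^ θ * Φ ^ (1 - θ) := by
        rw [← Real.rpow_add h]; simp
      have : Φ ^ θ ≤ D * 2 ^ (k / θ) * N ^ θ := by
        refine le_of_mul_le_mul_right ?_ hp
        rw [← e]; linarith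
      calc Φ = (Φ ^ θ) ^ (1 / θ) := by
            rw [← Real.rpow_mul hΦ0, mul_one_div_cancel hθ0.ne', Real.rpow_one]
        _ ≤ (D * 2 ^ (k / θ) * N ^ θ) ^ (1 / θ) := by
            apply Real.rpow_le_rpow (by positivity) this (by positivity)
        _ = _ := by
            rw [Real.mul_rpow (by positivity) (by positivity), ← Real.rpow_mul hN0,
              mul_one_div_cancel hθ0.ne', Real.rpow_one]
  have := (hle s x hs hsσ hx).trans hfin
  have hp : 0 < (σ - s) ^ (k / θ) := Real.rpow_pos_of_pos (by linarith) _
  rw [Real.inv_rpow (by linarith)]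
  calc v x = ((σ - s) ^ (k / θ))⁻¹ * ((σ - s) ^ (k / θ) * v x) := by field_simp
    _ ≤ ((σ - s) ^ (k / θ))⁻¹ * ((D * 2 ^ (k / θ)) ^ (1 / θ) * N) := by gcongr
    _ = _ := by ring

lemma step_trivial {ι : Type*} {v : ι → ℝ} (hv : ∀ x, 0 ≤ v x) {W : ℝ} (hW : 1 ≤ W) {S B : Finset ι} (h : S ⊆ B)
    {β ρ : ℝ} (hβ : 0 < β) (hρ : 1 < ρ) : wn v W S (ρ * β) ≤ W ^ (1 / β) * wn v W B β := by
  have hW0 : 0 < W := by linarith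
  set V := W ^ (1 / β) * wn v W S β with hV
  have hN0 := wn_nonneg hv hW0 S β
  have hV0 : 0 ≤ V := by positivity
  have h1 : wn v W S (ρ * β) ≤ V := by
    have b : (∑ y ∈ S, v y ^ (ρ * β)) / W ≤ V ^ (ρ * β) := by
      have e : V ^ (ρ * β) = V ^ (ρ * β - β) * (W * ((∑ y ∈ S, v y ^ β) / W)) := by
        rw [← wn_rpow hv hW0 S hβ]
        have : W * wn v W S β ^ β = V ^ β := by
          rw [hV, Real.mul_rpow (by positivity) hN0, ← Real.rpow_mul hW0.le,
            one_div_mul_cancel hβ.ne', Real.rpow_one]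
        rw [this, ← Real.rpow_add_of_nonneg hV0 (by nlinarith) hβ.le]; congr 1; ring
      rw [e, mul_div_cancel₀ _ hW0.ne', Finset.mul_sum, div_le_iff₀ hW0]
      have hs0 : 0 ≤ ∑ y ∈ S, V ^ (ρ * β - β) * v y ^ β := Finset.sum_nonneg fun y _ => by
        have := Real.rpow_nonneg (hv y) β
        positivity
      refine le_trans ?_ (le_mul_of_one_le_right hs0 hW)
      refine Finset.sum_le_sum fun y hy => ?_
      have : v y ^ (ρ * β) = v y ^ (ρ * β - β) * v y ^ β := by
        rw [← Real.rpow_add_of_nonneg (hv y) (by nlinarith) hβ.le]; congr 1; ring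
      rw [this]
      have := Real.rpow_le_rpow (hv y) (le_wn hv hW0 S hβ hy) (show 0 ≤ ρ * β - β by nlinarith)
      exact mul_le_mul_of_nonneg_right this (Real.rpow_nonneg (hv y) _)
    have hρβ : 0 < ρ * β := by positivity
    unfold wn
    refine (Real.rpow_le_rpow (wsum_nonneg hv hW0 _ _) b (by positivity)).trans (le_of_eq ?_)
    rw [← Real.rpow_mul hV0, mul_one_div_cancel hρβ.ne', Real.rpow_one]
  refine h1.trans ?_
  rw [hV]
  gcongr
  exact wn_mono hv hW0 h hβ

lemma abs_step {ι : Type*} (S B : Finset ι) (hSB : S ⊆ B) (c : ι → ι → ℝ)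
    (hsym : ∀ x y, c x y = c y x)
    (hc : ∀ x y, 0 ≤ c x y) (η u φ G M N : ι → ℝ) (Λ : ℝ) (hη0 : ∀ x, 0 ≤ η x) (hη1 : ∀ x, η x ≤ 1)
    (hηS : ∀ x ∈ S, η x = 1)
    (hu : ∀ x, 0 ≤ u x) (hφ : ∀ x, 0 < φ x) (α : ℝ) (hα : 1 ≤ α)
    (hL : ∀ x ∈ B, η x ≠ 0 → 0 ≤ ∑ y ∈ B, c x y * (u y - u x))
    (hG0 : ∀ x, 0 ≤ G x) (hM0 : ∀ x, 0 ≤ M x) (hN0 : ∀ x, 0 ≤ N x)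
    (hG : ∀ x ∈ B, ∑ y ∈ B, c x y * ((φ y - φ x) ^ 2 / (φ x * φ y)) ≤ G x)
    (hM : ∀ x ∈ B, ∑ y ∈ B, c x y ≤ M x) (hΛ0 : 0 ≤ Λ)
    (hΛ : ∀ x ∈ B, ∀ y ∈ B, 0 < c x y → (η y - η x) ^ 2 ≤ Λ)
    (hN : ∀ x ∈ B, ∑ y ∈ B, (if 0 < c x y then (c x y)⁻¹ else 0) ≤ N x)
    {ζ r e p p' q q' W K ρ P : ℝ} (hζ : 1 < ζ) (hr : 0 < r) (hq : q'.HolderConjugate q)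
    (hp : p'.HolderConjugate p) (hP : P = 2 * p') (heρ : e = ρ * P)
    (he1 : e = ζ * r) (he2 : e = 2 * (ζ - 1) * q') (hW : 0 < W) (hK : 0 ≤ K)
    (hsob : ((∑ x ∈ B, ((η x * (φ x * u x) ^ α) ^ ζ) ^ r) / W) ^ (1 / r) ≤
      K / W * (1 / 2 * ∑ x ∈ B, ∑ y ∈ B, if 0 < c x y then
        |(η y * (φ y * u y) ^ α) ^ ζ - (η x * (φ x * u x) ^ α) ^ ζ| else 0)) :
    wn (fun x => φ x * u x) W S (ρ * (α * P)) ≤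
      (74 * α ^ 2 * (K * ζ) ^ 2 * wn N W B q * (wn G W B p + Λ * wn M W B p)) ^ (1 / (2 * α)) *
        wn (fun x => φ x * u x) W B (α * P) := by
  set v : ι → ℝ := fun x => φ x * u x with hv
  have hv0 : ∀ x, 0 ≤ v x := fun x => mul_nonneg (hφ x).le (hu x)
  have hα0 : 0 < α := by linarith
  have hp0 : 0 < p' := hp.pos
  have hP0 : 0 < P := by rw [hP]; positivity
  have he0 : 0 < e := by rw [he1]; nlinarith
  have h1 := sobw B c hsym hc (fun x => η x * v x ^ α) N
    (fun x => mul_nonneg (hη0 x) (Real.rpow_nonneg (hv0 x) _)) hN hζ hr hq he1 he2 hW hK hsob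
  have h2 := cacc2 B c hsym hc η u φ G M Λ hη0 hη1 hu hφ α hα hL hG hM hΛ0 hΛ
  set w : ι → ℝ := fun x => (v x ^ α) ^ 2 with hw
  have hw0 : ∀ x, 0 ≤ w x := fun x => sq_nonneg _
  set X := (∑ x ∈ S, v x ^ (α * e)) / W with hX
  have hX0 : 0 ≤ X := wsum_nonneg hv0 hW _ _
  set Y := wn v W B (α * P) with hY
  have hY0 : 0 ≤ Y := wn_nonneg hv0 hW _ _
  have hXle : X ≤ (∑ x ∈ B, (η x * v x ^ α) ^ e) / W := by
    rw [hX]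
    gcongr
    calc ∑ x ∈ S, v x ^ (α * e) = ∑ x ∈ S, (η x * v x ^ α) ^ e := by
          refine Finset.sum_congr rfl fun x hx => ?_
          rw [hηS x hx, one_mul, ← Real.rpow_mul (hv0 x)]
      _ ≤ _ := Finset.sum_le_sum_of_subset_of_nonneg hSB fun x _ _ =>
          Real.rpow_nonneg (mul_nonneg (hη0 x) (Real.rpow_nonneg (hv0 x) _)) _
  have hwY : ((∑ x ∈ B, w x ^ p') / W) ^ (1 / p') = Y ^ (2 * α) := by
    have e1 : ∀ x, w x ^ p' = v x ^ (α * P) := fun x => by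
      simp only [hw]
      rw [← Real.rpow_natCast, ← Real.rpow_mul (hv0 x), ← Real.rpow_mul (hv0 x), hP]
      congr 1; push_cast; ring
    simp only [e1, hY, wn]
    rw [← Real.rpow_mul (wsum_nonneg hv0 hW _ _), hP]
    congr 1; field_simp
  have hg1 := holder_avg B w G (fun x _ => hw0 x) (fun x _ => hG0 x) hp hW
  have hg2 := holder_avg B w M (fun x _ => hw0 x) (fun x _ => hM0 x) hp hW
  rw [hwY] at hg1 hg2
  have hGn : ((∑ x ∈ B, G x ^ p) / W) ^ (1 / p) = wn G W B p := rfl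
  have hMn : ((∑ x ∈ B, M x ^ p) / W) ^ (1 / p) = wn M W B p := rfl
  have hNn : ((∑ x ∈ B, N x ^ q) / W) ^ (1 / q) = wn N W B q := rfl
  rw [hGn] at hg1; rw [hMn] at hg2; rw [hNn] at h1
  have hNn0 := wn_nonneg hN0 hW B q
  have hGn0 := wn_nonneg hG0 hW B p
  have hMn0 := wn_nonneg hM0 hW B p
  have hE : (∑ x ∈ B, ∑ y ∈ B, c x y * (η y * v y ^ α - η x * v x ^ α) ^ 2) / W ≤
      74 * α ^ 2 * (Y ^ (2 * α) * (wn G W B p + Λ * wn M W B p)) := by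
    rw [div_le_iff₀ hW]
    refine h2.trans ?_
    have e3 : ∑ x ∈ B, ((φ x * u x) ^ α) ^ 2 * (G x + Λ * M x) =
        ∑ x ∈ B, w x * G x + Λ * ∑ x ∈ B, w x * M x := by
      rw [Finset.mul_sum, ← Finset.sum_add_distrib]
      refine Finset.sum_congr rfl fun x _ => by simp only [hw, hv]; ring
    rw [e3]
    have := mul_le_mul_of_nonneg_left hg2 hΛ0
    have h4 : ∑ x ∈ B, w x * G x + Λ * ∑ x ∈ B, w x * M x ≤
      W * (Y ^ (2 * α) * wn G W B p) + Λ * (W * (Y ^ (2 * α) * wn M W B p)) := add_le_add hg1 this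
    calc _ ≤ 74 * α ^ 2 * (W * (Y ^ (2 * α) * wn G W B p) + Λ * (W * (Y ^ (2 * α) * wn M W B p))) := by
          gcongr
      _ = _ := by ring
  have hfin : X ^ (2 / e) ≤ (74 * α ^ 2 * (K * ζ) ^ 2 * wn N W B q *
      (wn G W B p + Λ * wn M W B p)) * Y ^ (2 * α) := by
    calc X ^ (2 / e) ≤ ((∑ x ∈ B, (η x * v x ^ α) ^ e) / W) ^ (2 / e) :=
          Real.rpow_le_rpow hX0 hXle (by positivity)
      _ ≤ _ := h1
      _ ≤ (K * ζ) ^ 2 * wn N W B q * (74 * α ^ 2 * (Y ^ (2 * α) * (wn G W B p + Λ * wn M W B p))) := by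
          gcongr
      _ = _ := by ring
  have e5 : wn v W S (ρ * (α * P)) = (X ^ (2 / e)) ^ (1 / (2 * α)) := by
    rw [← Real.rpow_mul hX0, hX]
    have : ρ * (α * P) = α * e := by rw [heρ]; ring
    rw [this, wn]; congr 1; field_simp
  rw [e5]
  have hC0 : 0 ≤ 74 * α ^ 2 * (K * ζ) ^ 2 * wn N W B q * (wn G W B p + Λ * wn M W B p) := by positivity
  calc _ ≤ ((74 * α ^ 2 * (K * ζ) ^ 2 * wn N W B q *
      (wn G W B p + Λ * wn M W B p)) * Y ^ (2 * α)) ^ (1 / (2 * α)) :=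
        Real.rpow_le_rpow (Real.rpow_nonneg hX0 _) hfin (by positivity)
    _ = _ := by
      rw [Real.mul_rpow hC0 (Real.rpow_nonneg hY0 _), ← Real.rpow_mul hY0]
      rw [mul_one_div_cancel (by positivity), Real.rpow_one]

/-- choice of exponents -/
lemma exps {d' p q : ℝ} (hd : 2 ≤ d') (hp : 1 < p) (hq : 1 < q) (h : 1 / p + 1 / q < 2 / d') :
    ∃ ζ e p' q' ρ P : ℝ, 1 < ζ ∧ q'.HolderConjugate q ∧ p'.HolderConjugate p ∧ P = 2 * p' ∧
      e = ρ * P ∧ e = ζ * (d' / (d' - 1)) ∧ e = 2 * (ζ - 1) * q' ∧ 1 < ρ := by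
  have hd0 : 0 < d' - 1 := by linarith
  have hd1 : 0 < d' := by linarith
  have hq1 : 0 < q - 1 := by linarith
  have hp1 : 0 < p - 1 := by linarith
  have hpq' : d' * (p + q) < 2 * p * q := by
    have := (div_add_div _ _ (by positivity : p ≠ 0) (by positivity : q ≠ 0)) ▸ h
    rw [div_lt_div_iff₀ (by positivity) hd1] at this
    nlinarith
  have hk : 0 < q * d' - 2 * q + d' := by nlinarith
  refine ⟨2 * q * (d' - 1) / (q * d' - 2 * q + d'), 2 * q * d' / (q * d' - 2 * q + d'),
    p / (p - 1), q / (q - 1), (q * d' / (q * d' - 2 * q + d')) / (p / (p - 1)),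
    2 * (p / (p - 1)), ?_, ?_, ?_, rfl, ?_, ?_, ?_, ?_⟩
  · rw [one_lt_div hk]; nlinarith
  · exact (Real.HolderConjugate.conjExponent hq).symm
  · exact (Real.HolderConjugate.conjExponent hp).symm
  · field_simp
  · field_simp
  · have e1 : 2 * q * (d' - 1) / (q * d' - 2 * q + d') - 1 =
        d' * (q - 1) / (q * d' - 2 * q + d') := by
      rw [eq_div_iff hk.ne', sub_mul, div_mul_cancel₀ _ hk.ne']; ring
    rw [e1]; field_simp
  · rw [one_lt_div (by positivity), div_lt_div_iff₀ hp1 hk]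
    nlinarith

lemma adj_symm {d : ℕ} {x y : Vert d} (h : adj x y) : adj y x := by
  unfold adj at *
  rw [← h]
  refine Finset.sum_congr rfl fun i _ => ?_
  rw [← Int.natAbs_neg]; congr 1; ring

lemma mem_nbrs {d : ℕ} {x y : Vert d} : y ∈ nbrs x ↔ adj x y := by
  unfold nbrs adj
  simp only [Finset.mem_image, Finset.mem_univ, true_and, Prod.exists]
  constructor
  · rintro ⟨i, b, rfl⟩
    rw [Finset.sum_eq_single i]
    · cases b <;> simp
    · intro j _ hj
      simp [Function.update_of_ne hj]
    · simp
  · intro h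
    have hne : ∃ i, (x i - y i).natAbs ≠ 0 := by
      by_contra hcon
      push Not at hcon
      simp [hcon] at h
    obtain ⟨i, hi⟩ := hne
    have h2 := Finset.add_sum_erase Finset.univ (fun i => (x i - y i).natAbs) (Finset.mem_univ i)
    have h3 : ∑ j ∈ Finset.univ.erase i, (x j - y j).natAbs = 0 := by omega
    have h4 : ∀ j, j ≠ i → x j = y j := fun j hj => by
      have := (Finset.sum_eq_zero_iff.1 h3) j (Finset.mem_erase.2 ⟨hj, Finset.mem_univ _⟩)
      omega
    have h5 : (x i - y i).natAbs = 1 := by omega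
    refine ⟨i, decide (y i = x i + 1), ?_⟩
    funext j
    by_cases hj : j = i
    · subst hj
      simp only [Function.update_self, decide_eq_true_eq]
      split_ifs with hh <;> omega
    · rw [Function.update_of_ne hj, h4 j hj]

lemma adj_coord {d : ℕ} {x y : Vert d} (h : adj x y) (i : Fin d) : (y i - x i).natAbs ≤ 1 := by
  have := adj_symm h
  unfold adj at this
  rw [← this]
  exact Finset.single_le_sum (f := fun i => (y i - x i).natAbs) (fun _ _ => Nat.zero_le _) (Finset.mem_univ i)

lemma openAdj_symm {d : ℕ} {a : Vert d → Vert d → ℝ} (hs : ∀ x y, a x y = a y x) {x y : Vert d}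
    (h : openAdj a x y) : openAdj a y x := ⟨adj_symm h.1, hs x y ▸ h.2⟩

lemma chem_self {d : ℕ} (a : Vert d → Vert d → ℝ) (x : Vert d) : chemDist a x x = 0 := by
  unfold chemDist
  refine le_antisymm ?_ bot_le
  refine iInf_le_of_le ⟨[x], ?_⟩ (by simp)
  exact ⟨rfl, rfl, List.isChain_singleton _⟩

lemma chem_step {d : ℕ} {a : Vert d → Vert d → ℝ} {x y z : Vert d} (h : openAdj a y z) :
    chemDist a x z ≤ chemDist a x y + 1 := by
  unfold chemDist
  rw [ENNReal.iInf_add]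
  refine le_iInf fun ⟨p, hp⟩ => ?_
  obtain ⟨h1, h2, h3⟩ := hp
  have hne : p ≠ [] := by rintro rfl; simp at h1
  refine iInf_le_of_le ⟨p ++ [z], ?_, ?_, ?_⟩ ?_
  · rw [List.head?_append_of_ne_nil _ hne]; exact h1
  · simp
  · refine List.IsChain.append h3 (by simp) ?_
    intro w hw z' hz'
    rw [h2] at hw
    simp at hw hz'
    subst hw; subst hz'; exact h
  · have : 0 < p.length := List.length_pos_iff.2 hne
    have e : (p ++ [z]).length - 1 = (p.length - 1) + 1 := by simp; omega
    simp only [e]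
    push_cast
    exact le_rfl

lemma path_coord {d : ℕ} {a : Vert d → Vert d → ℝ} (p : List (Vert d)) : ∀ x y : Vert d,
    IsOpenPath a x y p → ∀ i, (y i - x i).natAbs ≤ p.length - 1 := by
  induction p with
  | nil => intro x y h; simp [IsOpenPath] at h
  | cons b l ih =>
    intro x y h i
    obtain ⟨h1, h2, h3⟩ := h
    simp at h1
    subst h1
    cases l with
    | nil => simp at h2; subst h2; simp
    | cons c l =>
      have h3' : List.IsChain (openAdj a) (b :: c :: l) := h3
      rw [List.isChain_cons_cons] at h3'
      have := ih c y ⟨rfl, by simpa using h2, h3'.2⟩ i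
      have h5 := adj_coord h3'.1.1 i
      simp at this ⊢
      omega

lemma ball_finite {d : ℕ} (a : Vert d → Vert d → ℝ) (x : Vert d) (r : ℝ) : (ballCh a x r).Finite := by
  obtain ⟨m, hm⟩ := exists_nat_gt r
  have : ballCh a x r ⊆ Set.pi Set.univ (fun i => Set.Icc (x i - m) (x i + m)) := by
    intro y hy i _
    have hy' : chemDist a x y < ((m + 1 : ℕ) : ℝ≥0∞) := by
      refine lt_of_le_of_lt hy ?_
      rw [ENNReal.ofReal_lt_natCast (by omega)]
      push_cast; linarith
    unfold chemDist at hy'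
    obtain ⟨⟨p, hp⟩, hlt⟩ := iInf_lt_iff.1 hy'
    have h1 : p.length - 1 < m + 1 := by exact_mod_cast hlt
    have h2 := path_coord p x y hp i
    simp only [Set.mem_Icc]
    omega
  exact (Set.Finite.pi' fun i => Set.finite_Icc _ _).subset (by
    intro y hy i; exact this hy i (Set.mem_univ i))

lemma mem_ball {d : ℕ} {a : Vert d → Vert d → ℝ} {x y : Vert d} {r : ℝ} (hr : 0 ≤ r) :
    y ∈ ballCh a x r ↔ chemDist a x y ≠ ∞ ∧ (chemDist a x y).toReal ≤ r := by
  constructor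
  · intro h
    have h1 : chemDist a x y ≠ ∞ := ne_top_of_le_ne_top ENNReal.ofReal_ne_top h
    exact ⟨h1, ENNReal.toReal_le_of_le_ofReal hr h⟩
  · rintro ⟨h1, h2⟩
    exact (ENNReal.le_ofReal_iff_toReal_le h1 hr).2 h2

lemma chem_step_real {d : ℕ} {a : Vert d → Vert d → ℝ} {x y z : Vert d} (h : openAdj a y z)
    (hy : chemDist a x y ≠ ∞) :
    chemDist a x z ≠ ∞ ∧ (chemDist a x z).toReal ≤ (chemDist a x y).toReal + 1 := by
  have h1 := chem_step (x := x) h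
  have h2 : chemDist a x y + 1 ≠ ∞ := ENNReal.add_ne_top.2 ⟨hy, ENNReal.one_ne_top⟩
  refine ⟨ne_top_of_le_ne_top h2 h1, ?_⟩
  have := ENNReal.toReal_mono h2 h1
  rwa [ENNReal.toReal_add hy ENNReal.one_ne_top, ENNReal.toReal_one] at this

/-- finset version of the ball -/
noncomputable def fball {d : ℕ} (a : Vert d → Vert d → ℝ) (x : Vert d) (r : ℝ) : Finset (Vert d) :=
  (ball_finite a x r).toFinset

lemma mem_fball {d : ℕ} {a : Vert d → Vert d → ℝ} {x y : Vert d} {r : ℝ} :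
    y ∈ fball a x r ↔ y ∈ ballCh a x r := by simp [fball]

lemma ncard_ball {d : ℕ} (a : Vert d → Vert d → ℝ) (x : Vert d) (r : ℝ) :
    (ballCh a x r).ncard = (fball a x r).card := by
  rw [fball, Set.ncard_eq_toFinset_card _ (ball_finite a x r)]

lemma fball_mono {d : ℕ} (a : Vert d → Vert d → ℝ) (x : Vert d) {r s : ℝ} (h : r ≤ s) :
    fball a x r ⊆ fball a x s := by
  intro y hy
  rw [mem_fball] at *
  exact le_trans hy (ENNReal.ofReal_le_ofReal h)

lemma center_mem {d : ℕ} (a : Vert d → Vert d → ℝ) (x : Vert d) (r : ℝ) : x ∈ fball a x r := by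
  rw [mem_fball]
  simp [ballCh, chem_self]

lemma avg_eq {d : ℕ} (a : Vert d → Vert d → ℝ) (x : Vert d) (r : ℝ) {p : ℝ≥0∞} (hp : p ≠ ∞)
    (f : Vert d → ℝ) : avgNormR p (ballCh a x r) f =
      wn (fun y => |f y|) (fball a x r).card (fball a x r) p.toReal := by
  unfold avgNormR wn
  rw [if_neg hp, ncard_ball]
  congr 2
  rw [← Finset.tsum_subtype' (fball a x r) (fun y => |f y| ^ p.toReal)]
  have : (↑(fball a x r) : Set (Vert d)) = ballCh a x r := by simp [fball]
  rw [this]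

lemma avg_mono {d : ℕ} (a : Vert d → Vert d → ℝ) (x : Vert d) (r : ℝ) {p : ℝ≥0∞} {p1 : ℝ}
    (hp1 : 0 < p1) (h : ENNReal.ofReal p1 ≤ p) (f : Vert d → ℝ) :
    wn (fun y => |f y|) (fball a x r).card (fball a x r) p1 ≤ avgNormR p (ballCh a x r) f := by
  have hc : (0:ℝ) < (fball a x r).card := by
    exact_mod_cast Finset.card_pos.2 ⟨x, center_mem a x r⟩
  by_cases hp : p = ∞
  · unfold avgNormR
    rw [if_pos hp]
    set Z := sSup ((fun x => |f x|) '' ballCh a x r)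
    have hZ : ∀ y ∈ fball a x r, |f y| ≤ Z := fun y hy =>
      le_csSup ((ball_finite a x r).image _).bddAbove ⟨y, mem_fball.1 hy, rfl⟩
    have hZ0 : 0 ≤ Z := (abs_nonneg _).trans (hZ x (center_mem a x r))
    unfold wn
    have : (∑ y ∈ fball a x r, |f y| ^ p1) / (fball a x r).card ≤ Z ^ p1 := by
      rw [div_le_iff₀ hc, mul_comm, ← nsmul_eq_mul]
      exact Finset.sum_le_card_nsmul _ _ _ fun y hy => Real.rpow_le_rpow (abs_nonneg _) (hZ y hy) hp1.le
    calc _ ≤ (Z ^ p1) ^ (1 / p1) := Real.rpow_le_rpow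
          (wsum_nonneg (v := fun y => |f y|) (fun y => abs_nonneg _) hc _ _) this (by positivity)
      _ = Z := by rw [← Real.rpow_mul hZ0, mul_one_div_cancel hp1.ne', Real.rpow_one]
  · rw [avg_eq a x r hp]
    refine wn_jensen (fun y => abs_nonneg _) hc _ le_rfl hp1 ?_
    exact (ENNReal.ofReal_le_iff_le_toReal hp).1 h

/-- conductances restricted to lattice edges -/
noncomputable def cc {d : ℕ} (a : Vert d → Vert d → ℝ) (x y : Vert d) : ℝ :=
  if y ∈ nbrs x then a x y else 0

lemma cc_symm {d : ℕ} {a : Vert d → Vert d → ℝ} (hs : ∀ x y, a x y = a y x) (x y : Vert d) :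
    cc a x y = cc a y x := by
  unfold cc
  have : y ∈ nbrs x ↔ x ∈ nbrs y := by
    rw [mem_nbrs, mem_nbrs]; exact ⟨adj_symm, adj_symm⟩
  simp only [this, hs x y]

lemma cc_nonneg {d : ℕ} {a : Vert d → Vert d → ℝ} (ha : ∀ x y, 0 ≤ a x y) (x y : Vert d) :
    0 ≤ cc a x y := by
  unfold cc; split_ifs
  · exact ha x y
  · exact le_rfl

lemma cc_pos {d : ℕ} {a : Vert d → Vert d → ℝ} {x y : Vert d} : 0 < cc a x y ↔ openAdj a x y := by
  unfold cc openAdj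
  rw [← mem_nbrs]
  split_ifs with h <;> simp [h]

lemma sum_cc {d : ℕ} (a : Vert d → Vert d → ℝ) (B : Finset (Vert d)) (x : Vert d) (g : Vert d → ℝ) :
    ∑ y ∈ B, cc a x y * g y = ∑ y ∈ nbrs x, if y ∈ B then a x y * g y else 0 := by
  rw [← Finset.sum_filter]
  have : ∀ y, cc a x y * g y = if y ∈ nbrs x then a x y * g y else 0 := fun y => by
    unfold cc; split_ifs <;> simp
  simp only [this]
  rw [← Finset.sum_filter]
  congr 1
  ext y; simp [and_comm]

lemma sob_graph {d : ℕ} {a : Vert d → Vert d → ℝ} (hs : ∀ x y, a x y = a y x) {x0 : Vert d} {n : ℕ}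
    {C r t : ℝ} (hr : 0 < r) (ht : t ≤ n)
    (H : ∀ f : Vert d → ℝ,
    (∀ y, f y ≠ 0 → y ∈ ballCh a x0 n) →
    avgNormR (ENNReal.ofReal r) (ballCh a x0 n) f ≤
      C * n / ((ballCh a x0 n).ncard : ℝ) * edgeGradSum a f)
    (f : Vert d → ℝ) (hf : ∀ x, 0 ≤ f x)
    (hsupp : ∀ y, f y ≠ 0 → y ∈ fball a x0 t ∧ ∀ z, openAdj a y z → z ∈ fball a x0 t) :
    ((∑ x ∈ fball a x0 t, f x ^ r) / ((fball a x0 n).card : ℝ)) ^ (1 / r) ≤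
      C * n / ((fball a x0 n).card : ℝ) * (1 / 2 * ∑ x ∈ fball a x0 t, ∑ y ∈ fball a x0 t,
        if 0 < cc a x y then |f y - f x| else 0) := by
  have hsub := fball_mono a x0 ht
  have h := H f (fun y hy => mem_fball.1 (hsub (hsupp y hy).1))
  rw [avg_eq a x0 n ENNReal.ofReal_ne_top, ENNReal.toReal_ofReal hr.le, ncard_ball] at h
  unfold wn edgeGradSum at h
  have e1 : ∑ x ∈ fball a x0 n, |f x| ^ r = ∑ x ∈ fball a x0 t, f x ^ r := by
    rw [← Finset.sum_subset hsub]
    · exact Finset.sum_congr rfl fun x _ => by rw [abs_of_nonneg (hf x)]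
    · intro x _ hx
      have : f x = 0 := by
        by_contra h0
        exact hx (hsupp x h0).1
      rw [this, abs_zero, Real.zero_rpow hr.ne']
  have e2 : (∑' e : Vert d × Vert d, if openAdj a e.1 e.2 then |f e.2 - f e.1| else 0) =
      ∑ x ∈ fball a x0 t, ∑ y ∈ fball a x0 t, if 0 < cc a x y then |f y - f x| else 0 := by
    rw [tsum_eq_sum (s := fball a x0 t ×ˢ fball a x0 t), Finset.sum_product]
    · simp only [cc_pos]
    · rintro ⟨x, y⟩ hxy
      simp only
      split_ifs with ho
      · have hx : f x = 0 := by
          by_contra h0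
          obtain ⟨h1, h2⟩ := hsupp x h0
          exact hxy (Finset.mem_product.2 ⟨h1, h2 y ho⟩)
        have hy : f y = 0 := by
          by_contra h0
          obtain ⟨h1, h2⟩ := hsupp y h0
          exact hxy (Finset.mem_product.2 ⟨h2 x (openAdj_symm hs ho), h1⟩)
        simp [hx, hy]
      · rfl
  rw [e1, e2] at h
  exact h

lemma wn_ge_one {ι : Type*} {f : ι → ℝ} (hf : ∀ x, 1 ≤ f x) (B : Finset ι) (hB : 0 < B.card) {p : ℝ}
    (hp : 0 < p) : 1 ≤ wn f B.card B p := by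
  unfold wn
  have hc : (0:ℝ) < B.card := by exact_mod_cast hB
  refine Real.one_le_rpow ?_ (by positivity)
  rw [one_le_div hc]
  calc (B.card : ℝ) = ∑ x ∈ B, (1:ℝ) := by simp
    _ ≤ _ := Finset.sum_le_sum fun x _ => Real.one_le_rpow (hf x) hp.le

/-- the radial cutoff -/
noncomputable def cut {d : ℕ} (a : Vert d → Vert d → ℝ) (x0 : Vert d) (T δ : ℝ) (x : Vert d) : ℝ :=
  if chemDist a x0 x = ∞ then 0 else max 0 (min 1 ((T - 1 - (chemDist a x0 x).toReal) / δ))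

lemma cut_nonneg {d : ℕ} (a : Vert d → Vert d → ℝ) (x0 : Vert d) (T δ : ℝ) (x : Vert d) :
    0 ≤ cut a x0 T δ x := by
  unfold cut; split_ifs
  · exact le_rfl
  · exact le_max_left _ _

lemma cut_le_one {d : ℕ} (a : Vert d → Vert d → ℝ) (x0 : Vert d) (T δ : ℝ) (x : Vert d) :
    cut a x0 T δ x ≤ 1 := by
  unfold cut; split_ifs
  · exact zero_le_one
  · exact max_le zero_le_one (min_le_left _ _)

lemma cut_eq_one {d : ℕ} (a : Vert d → Vert d → ℝ) (x0 : Vert d) {T S : ℝ} (hS : 0 ≤ S) (hST : S + 1 < T)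
    {x : Vert d} (hx : x ∈ fball a x0 S) : cut a x0 T (T - 1 - S) x = 1 := by
  rw [mem_fball, mem_ball hS] at hx
  unfold cut
  rw [if_neg hx.1, min_eq_left, max_eq_right zero_le_one]
  rw [one_le_div (by linarith)]
  linarith [hx.2]

lemma cut_supp {d : ℕ} (a : Vert d → Vert d → ℝ) (x0 : Vert d) {T δ : ℝ} (hT : 0 ≤ T) (hδ : 0 < δ)
    {x : Vert d} (hx : cut a x0 T δ x ≠ 0) : x ∈ fball a x0 T ∧ ∀ z, openAdj a x z → z ∈ fball a x0 T := by
  unfold cut at hx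
  split_ifs at hx with h
  · exact absurd rfl hx
  · have h1 : (chemDist a x0 x).toReal < T - 1 := by
      by_contra hc
      apply hx
      have : (T - 1 - (chemDist a x0 x).toReal) / δ ≤ 0 := div_nonpos_of_nonpos_of_nonneg (by linarith) hδ.le
      exact max_eq_left ((min_le_right _ _).trans this)
    refine ⟨?_, fun z hz => ?_⟩
    · rw [mem_fball, mem_ball hT]; exact ⟨h, by linarith⟩
    · have := chem_step_real hz h
      rw [mem_fball, mem_ball hT]; exact ⟨this.1, by linarith [this.2]⟩

lemma clamp_lip (x y : ℝ) : |max 0 (min 1 y) - max 0 (min 1 x)| ≤ |y - x| := by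
  rw [max_comm 0, max_comm 0]
  refine (abs_max_sub_max_le_abs _ _ _).trans ?_
  have := abs_min_sub_min_le_max 1 y 1 x
  simpa using this

lemma cut_lip {d : ℕ} {a : Vert d → Vert d → ℝ} (hs : ∀ x y, a x y = a y x) (x0 : Vert d) {T δ : ℝ} (hδ : 0 < δ)
    {x y : Vert d} (hxy : openAdj a x y) : (cut a x0 T δ y - cut a x0 T δ x) ^ 2 ≤ (1 / δ) ^ 2 := by
  rw [← sq_abs]
  have : |cut a x0 T δ y - cut a x0 T δ x| ≤ 1 / δ := by
    unfold cut
    by_cases hx : chemDist a x0 x = ∞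
    · by_cases hy : chemDist a x0 y = ∞
      · simp [hx, hy, hδ.le]
      · exact absurd hx (chem_step_real (openAdj_symm hs hxy) hy).1
    · have h1 := chem_step_real hxy hx
      have h2 := chem_step_real (openAdj_symm hs hxy) h1.1
      rw [if_neg hx, if_neg h1.1]
      refine (clamp_lip _ _).trans ?_
      rw [← sub_div, abs_div, abs_of_pos hδ]
      gcongr
      rw [abs_le]; constructor <;> linarith [h1.2, h2.2]
  gcongr

lemma nu_le {d : ℕ} (a : Vert d → Vert d → ℝ) (B : Finset (Vert d)) (x : Vert d) :
    ∑ y ∈ B, (if 0 < cc a x y then (cc a x y)⁻¹ else 0) ≤ nuA a x := by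
  unfold nuA
  have e : ∀ y, (if 0 < cc a x y then (cc a x y)⁻¹ else 0) =
      if y ∈ nbrs x then (if 0 < a x y then (a x y)⁻¹ else 0) else 0 := by
    intro y
    unfold cc
    by_cases h : y ∈ nbrs x
    · simp only [if_pos h]
    · simp only [if_neg h, lt_irrefl, if_false]
  simp only [e]
  rw [← Finset.sum_filter]
  refine Finset.sum_le_sum_of_subset_of_nonneg ?_ ?_
  · intro y hy; exact (Finset.mem_filter.1 hy).2
  · intro y _ _
    split_ifs with h0
    · exact (inv_pos.2 h0).le
    · exact le_rfl

set_option maxHeartbeats 800000 in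
lemma graph_step {d : ℕ} (hd : 2 ≤ d) {a : Vert d → Vert d → ℝ} (hs : ∀ x y, a x y = a y x)
    (ha : ∀ x y, 0 ≤ a x y) {κ : Vert d → ℝ} (hκ : ∀ x, 0 < κ x) {h : ℝ} (hh : 0 ≤ h)
    {x0 : Vert d} {n : ℕ} (hn : 1 ≤ n) {C Creg r : ℝ} (hC : 1 ≤ C) (hCreg : 1 ≤ Creg) (hr : 0 < r)
    (H : ∀ f : Vert d → ℝ,
    (∀ y, f y ≠ 0 → y ∈ ballCh a x0 n) →
    avgNormR (ENNReal.ofReal r) (ballCh a x0 n) f ≤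
      C * n / ((ballCh a x0 n).ncard : ℝ) * edgeGradSum a f)
    (hvol : ((fball a x0 n).card : ℝ) ≤ Creg * (n : ℝ) ^ d)
    {u : Vert d → ℝ} (hu : ∀ x, 0 ≤ u x) (hL : ∀ x ∈ ballCh a x0 (n : ℝ), 0 ≤ genL a κ h u x)
    {φ : Vert d → ℝ} (hφ : ∀ x, 0 < φ x)
    {ζ e p p' q q' ρ P m : ℝ} (hζ : 1 < ζ) (hq : q'.HolderConjugate q)
    (hp : p'.HolderConjugate p) (hP : P = 2 * p') (heρ : e = ρ * P)
    (he1 : e = ζ * r) (he2 : e = 2 * (ζ - 1) * q') (hρ : 1 < ρ)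
    (hm : wn (fun x => |max 1 (muA a x)|) (fball a x0 n).card (fball a x0 n) p *
      wn (fun x => |max 1 (nuA a x)|) (fball a x0 n).card (fball a x0 n) q *
      (1 + wn (fun x => |carre a φ (fun z => (φ z)⁻¹) x|) (fball a x0 n).card (fball a x0 n) p
        * (n:ℝ) ^ 2) ≤ m)
    (s t α : ℝ) (hs2 : 1 / 2 ≤ s) (hst : s < t) (ht1 : t ≤ 1) (hα : 1 ≤ α) :
    wn (fun x => φ x * u x) (fball a x0 n).card (fball a x0 (s * n)) (ρ * (α * P)) ≤
      ((296 * (C * ζ) ^ 2 + Creg * 2 ^ d) * m * α ^ 2 * ((t - s)⁻¹) ^ d) ^ (1 / (2 * α)) *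
        wn (fun x => φ x * u x) (fball a x0 n).card (fball a x0 (t * n)) (α * P) := by
  have hn0 : (0:ℝ) < n := by exact_mod_cast hn
  have hcard : 0 < (fball a x0 n).card := Finset.card_pos.2 ⟨x0, center_mem a x0 n⟩
  set W : ℝ := ((fball a x0 n).card : ℝ) with hWdef
  have hW1 : 1 ≤ W := by rw [hWdef]; exact_mod_cast hcard
  have hW : 0 < W := by linarith
  have hv : ∀ x, 0 ≤ φ x * u x := fun x => mul_nonneg (hφ x).le (hu x)
  have hp1 : 1 < p' := hp.lt
  have hP2 : 2 < P := by rw [hP]; linarith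
  have hα0 : 0 < α := by linarith
  have hpp : 0 < p := hp.symm.pos
  have hqq : 0 < q := hq.symm.pos
  set Mf : Vert d → ℝ := fun x => |max 1 (muA a x)| with hMf
  set Nf : Vert d → ℝ := fun x => |max 1 (nuA a x)| with hNf
  set Gf : Vert d → ℝ := fun x => |carre a φ (fun z => (φ z)⁻¹) x| with hGf
  have hM1 : ∀ x, 1 ≤ Mf x := fun x => (le_max_left _ _).trans (le_abs_self _)
  have hN1 : ∀ x, 1 ≤ Nf x := fun x => (le_max_left _ _).trans (le_abs_self _)
  have hG0 : ∀ x, 0 ≤ Gf x := fun x => abs_nonneg _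
  set Mn := wn Mf W (fball a x0 n) p with hMn
  set Nn := wn Nf W (fball a x0 n) q with hNn
  set Gn := wn Gf W (fball a x0 n) p with hGn
  have hMn1 : 1 ≤ Mn := wn_ge_one hM1 _ hcard hpp
  have hNn1 : 1 ≤ Nn := wn_ge_one hN1 _ hcard hqq
  have hGn0 : 0 ≤ Gn := wn_nonneg hG0 hW _ _
  have hm1 : 1 ≤ m := by
    refine le_trans ?_ hm
    exact one_le_mul_of_one_le_of_one_le (one_le_mul_of_one_le_of_one_le hMn1 hNn1)
      (by have : 0 ≤ Gn * (n:ℝ)^2 := by positivity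
          linarith)
  have hts : 0 < t - s := by linarith
  have hinv : 1 ≤ (t - s)⁻¹ := (one_le_inv₀ hts).2 (by linarith)
  have hwn0 := wn_nonneg hv hW (fball a x0 (t * n)) (α * P)
  have hsubst : fball a x0 (s * n) ⊆ fball a x0 (t * n) :=
    fball_mono a x0 (mul_le_mul_of_nonneg_right hst.le hn0.le)
  have htn : t * n ≤ n := by nlinarith
  have hsubt := fball_mono a x0 htn
  have hα2 : 1 ≤ α ^ 2 := one_le_pow₀ hα
  by_cases hsmall : (t - s) * n < 2
  · refine (step_trivial hv hW1 hsubst (by positivity) hρ).trans ?_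
    gcongr
    have hWle : W ≤ (296 * (C * ζ) ^ 2 + Creg * 2 ^ d) * m * α ^ 2 * ((t - s)⁻¹) ^ d := by
      have h1 : (n:ℝ) ≤ 2 * (t - s)⁻¹ := by
        rw [← div_eq_mul_inv, le_div_iff₀ hts]; linarith
      calc W ≤ Creg * (n:ℝ) ^ d := hvol
        _ ≤ Creg * (2 * (t - s)⁻¹) ^ d := by gcongr
        _ = (Creg * 2 ^ d) * 1 * 1 * ((t - s)⁻¹) ^ d := by rw [mul_pow]; ring
        _ ≤ _ := by
          gcongr
          have : 0 ≤ 296 * (C * ζ) ^ 2 := by positivity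
          linarith
    calc W ^ (1 / (α * P)) ≤ W ^ (1 / (2 * α)) := by
          refine Real.rpow_le_rpow_of_exponent_le hW1 ?_
          gcongr 1 / ?_
          nlinarith
      _ ≤ _ := Real.rpow_le_rpow hW.le hWle (by positivity)
  · push Not at hsmall
    set T := t * n with hT
    set S := s * n with hS
    have hTS : T - S = (t - s) * n := by rw [hT, hS]; ring
    have hS0 : 0 ≤ S := by rw [hS]; positivity
    set δ := T - 1 - S with hδ
    have hδ1 : (t - s) * n / 2 ≤ δ := by rw [hδ]; linarith
    have hδ0 : 0 < δ := by rw [hδ]; linarith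
    have hT0 : 0 ≤ T := by linarith
    set η := cut a x0 T δ with hη
    have hη0 : ∀ x, 0 ≤ η x := cut_nonneg a x0 T δ
    have hη1 : ∀ x, η x ≤ 1 := cut_le_one a x0 T δ
    have hsup : ∀ x, η x ≠ 0 → x ∈ fball a x0 T ∧ ∀ z, openAdj a x z → z ∈ fball a x0 T :=
      fun x hx => cut_supp a x0 hT0 hδ0 hx
    have hsob := sob_graph hs hr htn H (fun x => (η x * (φ x * u x) ^ α) ^ ζ)
      (fun x => Real.rpow_nonneg (mul_nonneg (hη0 x) (Real.rpow_nonneg (hv x) _)) _)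
      (fun x hx => hsup x (fun h0 => hx (by
        simp only [h0, zero_mul]; exact Real.zero_rpow (by positivity))))
    have key := abs_step (fball a x0 S) (fball a x0 T) hsubst (cc a) (cc_symm hs) (cc_nonneg ha)
      η u φ Gf Mf Nf ((1 / δ) ^ 2) hη0 hη1 (fun x hx => cut_eq_one a x0 hS0 (by linarith) hx) hu hφ α hα
      (by
        intro x hx hx0
        rw [sum_cc a _ x (fun y => u y - u x)]
        have h1 := hL x (mem_fball.1 (hsubt hx))
        unfold genL at h1
        have h2 : 0 ≤ h * κ x * u x := mul_nonneg (mul_nonneg hh (hκ x).le) (hu x)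
        have h3 : (∑ y ∈ nbrs x, if y ∈ fball a x0 T then a x y * (u y - u x) else 0) =
            ∑ y ∈ nbrs x, a x y * (u y - u x) := by
          refine Finset.sum_congr rfl fun y hy => ?_
          split_ifs with hyT
          · rfl
          · have : a x y = 0 := by
              by_contra hne
              exact hyT ((hsup x hx0).2 y ⟨mem_nbrs.1 hy, lt_of_le_of_ne (ha x y) (Ne.symm hne)⟩)
            rw [this, zero_mul]
        rw [h3]; linarith)
      hG0 (fun x => zero_le_one.trans (hM1 x)) (fun x => zero_le_one.trans (hN1 x))
      (by
        intro x _
        rw [sum_cc a _ x (fun y => (φ y - φ x) ^ 2 / (φ x * φ y))]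
        refine le_trans ?_ (neg_le_abs _)
        unfold carre
        rw [← Finset.sum_neg_distrib]
        refine Finset.sum_le_sum fun y _ => ?_
        have hx' := hφ x
        have hy' := hφ y
        have e : -(a x y * (φ y - φ x) * ((φ y)⁻¹ - (φ x)⁻¹)) =
            a x y * ((φ y - φ x) ^ 2 / (φ x * φ y)) := by
          field_simp
          ring
        rw [e]
        have := ha x y
        split_ifs
        · exact le_rfl
        · positivity)
      (by
        intro x _
        have := sum_cc a (fball a x0 T) x (fun _ => 1)
        simp only [mul_one] at this
        rw [this]
        refine le_trans ?_ ((le_max_right _ _).trans (le_abs_self _))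
        unfold muA
        refine Finset.sum_le_sum fun y _ => ?_
        split_ifs
        · exact le_rfl
        · exact ha x y)
      (by positivity)
      (fun x _ y _ hxy => cut_lip hs x0 hδ0 (cc_pos.1 hxy))
      (by
        intro x _
        exact (nu_le a _ x).trans ((le_max_right _ _).trans (le_abs_self _)))
      hζ hr hq hp hP heρ he1 he2 hW (by positivity) hsob
    refine key.trans ?_
    have hGT : wn Gf W (fball a x0 T) p ≤ Gn := wn_mono hG0 hW hsubt hpp
    have hMT : wn Mf W (fball a x0 T) p ≤ Mn := wn_mono (fun x => zero_le_one.trans (hM1 x)) hW hsubt hpp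
    have hNT : wn Nf W (fball a x0 T) q ≤ Nn := wn_mono (fun x => zero_le_one.trans (hN1 x)) hW hsubt hqq
    have hGT0 : 0 ≤ wn Gf W (fball a x0 T) p := wn_nonneg hG0 hW _ _
    have hMT0 : 0 ≤ wn Mf W (fball a x0 T) p := wn_nonneg (fun x => zero_le_one.trans (hM1 x)) hW _ _
    have hNT0 : 0 ≤ wn Nf W (fball a x0 T) q := wn_nonneg (fun x => zero_le_one.trans (hN1 x)) hW _ _
    refine mul_le_mul_of_nonneg_right (Real.rpow_le_rpow (by positivity) ?_ (by positivity)) hwn0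
    have hΛ : (1 / δ) ^ 2 ≤ 4 * ((t - s)⁻¹) ^ 2 / (n:ℝ) ^ 2 := by
      have : 1 / δ ≤ 2 * (t - s)⁻¹ / n := by
        rw [div_le_div_iff₀ hδ0 hn0]
        have : (t - s)⁻¹ * ((t - s) * n / 2) ≤ (t - s)⁻¹ * δ := by gcongr
        rw [← mul_div_assoc, ← mul_assoc, inv_mul_cancel₀ hts.ne'] at this
        linarith
      calc (1 / δ) ^ 2 ≤ (2 * (t - s)⁻¹ / n) ^ 2 := by gcongr
        _ = _ := by rw [div_pow, mul_pow]; norm_num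
    have hsq : 1 ≤ ((t - s)⁻¹) ^ 2 := one_le_pow₀ hinv
    calc 74 * α ^ 2 * (C * n * ζ) ^ 2 * wn Nf W (fball a x0 T) q *
          (wn Gf W (fball a x0 T) p + (1 / δ) ^ 2 * wn Mf W (fball a x0 T) p)
        ≤ 74 * α ^ 2 * (C * n * ζ) ^ 2 * Nn *
          (Gn + (4 * ((t - s)⁻¹) ^ 2 / (n:ℝ) ^ 2) * Mn) := by gcongr
      _ = 74 * α ^ 2 * (C * ζ) ^ 2 * Nn * (Gn * (n:ℝ) ^ 2 + 4 * ((t - s)⁻¹) ^ 2 * Mn) := by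
          field_simp
      _ ≤ 74 * α ^ 2 * (C * ζ) ^ 2 * Nn * (4 * ((t - s)⁻¹) ^ 2 * (Mn * (1 + Gn * (n:ℝ) ^ 2))) := by
          gcongr
          have h1 : Gn * (n:ℝ) ^ 2 ≤ ((t - s)⁻¹) ^ 2 * (Mn * (Gn * (n:ℝ) ^ 2)) := by
            rw [← mul_assoc]
            exact le_mul_of_one_le_left (by positivity) (one_le_mul_of_one_le_of_one_le hsq hMn1)
          have h2 : 0 ≤ ((t - s)⁻¹) ^ 2 * (Mn * (Gn * (n:ℝ) ^ 2)) := by positivity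
          nlinarith
      _ = 296 * (C * ζ) ^ 2 * (Mn * Nn * (1 + Gn * (n:ℝ) ^ 2)) * α ^ 2 * ((t - s)⁻¹) ^ 2 := by ring
      _ ≤ (296 * (C * ζ) ^ 2 + Creg * 2 ^ d) * m * α ^ 2 * ((t - s)⁻¹) ^ d := by
          gcongr
          have : 0 ≤ Creg * 2 ^ d := by positivity
          linarith

lemma red_exp {p : ℝ≥0∞} (hp : 1 < p) {ε : ℝ} (hε : 0 < ε) :
    ∃ p1 : ℝ, 1 < p1 ∧ ENNReal.ofReal p1 ≤ p ∧ 1 / p1 < (1 / p).toReal + ε := by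
  by_cases h : p = ∞
  · refine ⟨2 + 1 / ε, ?_, ?_, ?_⟩
    · have : 0 < 1 / ε := by positivity
      linarith
    · rw [h]; exact le_top
    · rw [h]
      simp only [ENNReal.div_top, ENNReal.toReal_zero, zero_add]
      rw [div_lt_iff₀ (by positivity)]
      have : ε * (2 + 1 / ε) = 2 * ε + 1 := by field_simp
      linarith
  · refine ⟨p.toReal, ?_, ?_, ?_⟩
    · rw [← ENNReal.toReal_one]
      exact (ENNReal.toReal_lt_toReal ENNReal.one_ne_top h).2 hp
    · rw [ENNReal.ofReal_toReal h]
    · rw [ENNReal.toReal_div, ENNReal.toReal_one]; linarith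

lemma red_exps {p q : ℝ≥0∞} (hp : 1 < p) (hq : 1 < q) {d' : ℝ} (hd : 0 < d')
    (hpq : 1 / p + 1 / q < ENNReal.ofReal (2 / d')) :
    ∃ p1 q1 : ℝ, 1 < p1 ∧ 1 < q1 ∧ ENNReal.ofReal p1 ≤ p ∧ ENNReal.ofReal q1 ≤ q ∧
      1 / p1 + 1 / q1 < 2 / d' := by
  have hne := hpq.ne_top
  rw [Ne, ENNReal.add_eq_top, not_or] at hne
  have h1 : (1 / p).toReal + (1 / q).toReal < 2 / d' := by
    rw [← ENNReal.toReal_add hne.1 hne.2]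
    have := (ENNReal.toReal_lt_toReal (ENNReal.add_ne_top.2 hne) ENNReal.ofReal_ne_top).2 hpq
    rwa [ENNReal.toReal_ofReal (by positivity)] at this
  set ε := (2 / d' - ((1 / p).toReal + (1 / q).toReal)) / 2 with hε
  have hε0 : 0 < ε := by rw [hε]; linarith
  obtain ⟨p1, a1, a2, a3⟩ := red_exp hp hε0
  obtain ⟨q1, b1, b2, b3⟩ := red_exp hq hε0
  exact ⟨p1, q1, a1, b1, a2, b2, by linarith⟩

lemma final_alg {A0 m B1 S0 k θ τ : ℝ} {T : ℝ} (hA0 : 1 ≤ A0) (hm : 1 ≤ m) (hB : 1 ≤ B1)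
    (hS : 0 ≤ S0) (hk : 0 ≤ k) (hθ : 0 < θ) (hτ : 1 ≤ τ) (hT : 1 ≤ T) :
    (((A0 * m * T) ^ S0 * B1) * 2 ^ (k / θ)) ^ (1 / θ) * τ ^ (k / θ) ≤
      (((A0 * T) ^ S0 * B1 * 2 ^ (k / θ)) ^ (1 / θ) * m * τ ^ 2) ^ (k / θ + S0 / θ + 2) := by
  have hm0 : 0 ≤ m := by linarith
  have hτ0 : 0 ≤ τ := by linarith
  have hAT : 1 ≤ A0 * T := one_le_mul_of_one_le_of_one_le hA0 hT
  have hkt : 0 ≤ k / θ := by positivity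
  have hst : 0 ≤ S0 / θ := by positivity
  set E := (A0 * T) ^ S0 * B1 * 2 ^ (k / θ) with hE
  have hE1 : 1 ≤ E := one_le_mul_of_one_le_of_one_le (one_le_mul_of_one_le_of_one_le
    (Real.one_le_rpow hAT hS) hB) (Real.one_le_rpow (by norm_num) hkt)
  have e1 : ((A0 * m * T) ^ S0 * B1) * 2 ^ (k / θ) = m ^ S0 * E := by
    rw [hE, show A0 * m * T = m * (A0 * T) by ring, Real.mul_rpow hm0 (by linarith)]; ring
  have hc1 : 1 ≤ E ^ (1 / θ) := Real.one_le_rpow hE1 (by positivity)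
  have hτ2 : τ ≤ τ ^ 2 := by nlinarith
  clear_value E
  set g := k / θ + S0 / θ + 2 with hg
  rw [e1, Real.mul_rpow (Real.rpow_nonneg hm0 _) (by linarith), ← Real.rpow_mul hm0,
    Real.mul_rpow (by positivity) (by positivity), Real.mul_rpow (by linarith) hm0, mul_one_div,
    mul_comm (m ^ _)]
  gcongr ?_ * ?_ * ?_
  · calc E ^ (1 / θ) = (E ^ (1 / θ)) ^ (1:ℝ) := (Real.rpow_one _).symm
      _ ≤ _ := Real.rpow_le_rpow_of_exponent_le hc1 (by linarith)
  · exact Real.rpow_le_rpow_of_exponent_le hm (by linarith)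
  · calc τ ^ (k / θ) ≤ τ ^ g := Real.rpow_le_rpow_of_exponent_le hτ (by linarith)
      _ ≤ _ := Real.rpow_le_rpow hτ0 hτ2 (by linarith)

set_option maxHeartbeats 1600000 in
lemma main_aux
    {d : ℕ} (hd : 2 ≤ d) (d' Creg CS1 : ℝ)
    (α : ℝ) (hα : 0 < α)
    (p q : ℝ≥0∞) (hp : 1 < p) (hq : 1 < q)
    (hpq : 1 / p + 1 / q < ENNReal.ofReal (2 / d')) :
    ∃ γ c34 : ℝ, 1 < γ ∧ 0 < c34 ∧
      ∀ (a : Vert d → Vert d → ℝ), (∀ x y, a x y = a y x) → (∀ x y, 0 ≤ a x y) →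
      ∀ κ : Vert d → ℝ, (∀ x, 0 < κ x) → ∀ h ∈ Set.Icc (0:ℝ) 1,
      ∀ N4 N5 : Vert d → ℕ, GraphAssumption d' a N4 N5 Creg CS1 →
      ∀ x0 ∈ Cinf a, ∀ n : ℕ, 2 * max (N4 x0) (N5 x0) ≤ n →
      ∀ u : Vert d → ℝ, (∀ x, 0 ≤ u x) →
        (∀ x ∈ ballCh a x0 (n : ℝ), 0 ≤ genL a κ h u x) →
      ∀ phi : Vert d → ℝ, (∀ x, 0 < phi x) →
      ∀ σ' σ : ℝ, 1 / 2 ≤ σ' → σ' < σ → σ ≤ 1 →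
      ∀ x ∈ ballCh a x0 (σ' * n),
        phi x * u x ≤
          (c34 * mBound a p q phi x0 n / (σ - σ') ^ 2) ^ γ *
            avgNormR (ENNReal.ofReal α) (ballCh a x0 (σ * n))
              (fun z => phi z * u z) := by
  by_cases hpar : (d:ℝ) ≤ d' ∧ 1 ≤ Creg ∧ 1 ≤ CS1
  swap
  · refine ⟨2, 1, by norm_num, by norm_num, ?_⟩
    intro a _ _ κ _ h _ N4 N5 hG
    exact absurd ⟨hG.2.2.1, hG.1, hG.2.1⟩ hpar
  obtain ⟨hdd', hCreg, hCS1⟩ := hpar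
  have hd2 : (2:ℝ) ≤ d' := le_trans (by exact_mod_cast hd) hdd'
  obtain ⟨p1, q1, hp1, hq1, hpp, hqq, hpq1⟩ := red_exps hp hq (by linarith) hpq
  obtain ⟨ζ, e, p', q', ρ, P, hζ, hq', hp', hP, heρ, he1, he2, hρ⟩ := exps hd2 hp1 hq1 hpq1
  have hr : 0 < d' / (d' - 1) := div_pos (by linarith) (by linarith)
  have hP0 : 0 < P := by rw [hP]; have := hp'.pos; linarith
  set S0 := ∑' j : ℕ, (1 / 2 : ℝ) * (ρ⁻¹) ^ j with hS0
  set S1 := ∑' j : ℕ, (1 / 2 : ℝ) * (j * (ρ⁻¹) ^ j) with hS1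
  have hρ0 : 0 < ρ := by linarith
  have hS0n : 0 ≤ S0 := tsum_nonneg fun j => by positivity
  have hS1n : 0 ≤ S1 := tsum_nonneg fun j => by positivity
  set A0 := 296 * (CS1 * ζ) ^ 2 + Creg * 2 ^ d with hA0
  have h2d : (1:ℝ) ≤ 2 ^ d := one_le_pow₀ (by norm_num)
  have hA01 : 1 ≤ A0 := by
    have h1 : 1 ≤ Creg * 2 ^ d := one_le_mul_of_one_le_of_one_le hCreg h2d
    have h2 : 0 ≤ 296 * (CS1 * ζ) ^ 2 := by positivity
    linarith
  set B1 := (ρ ^ 2 * 2 ^ d) ^ S1 with hB1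
  have hB11 : 1 ≤ B1 := Real.one_le_rpow (one_le_mul_of_one_le_of_one_le (one_le_pow₀ hρ.le) h2d) hS1n
  set α' := min α P with hα'
  have hα'0 : 0 < α' := lt_min hα hP0
  have hθ0 : 0 < α' / P := by positivity
  set θ := α' / P with hθ
  set k : ℝ := d * S0 with hk
  have hk0 : 0 ≤ k := by positivity
  refine ⟨k / θ + S0 / θ + 2, ((A0 * 2 ^ d) ^ S0 * B1 * 2 ^ (k / θ)) ^ (1 / θ), ?_, by positivity, ?_⟩
  · have h1 : 0 ≤ k / θ := by positivity
    have h2 : 0 ≤ S0 / θ := by positivity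
    linarith
  intro a hs ha κ hκ h hh N4 N5 hG x0 hx0 n hn u hu hL phi hphi σ' σ hσ' hσσ hσ x hx
  obtain ⟨-, -, -, hvol, hsob⟩ := hG
  have hN4 : 1 ≤ N4 x0 := by
    by_contra hc
    have h0 := (hvol x0 hx0 0 (by omega)).2
    rw [Nat.cast_zero, zero_pow (by omega), mul_zero, ncard_ball] at h0
    have : 0 < (fball a x0 0).card := Finset.card_pos.2 ⟨x0, center_mem a x0 0⟩
    have h' : (0:ℝ) < (fball a x0 0).card := by exact_mod_cast this
    linarith
  have hn4 : N4 x0 ≤ n := by have := le_max_left (N4 x0) (N5 x0); omega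
  have hn5 : N5 x0 ≤ n := by have := le_max_right (N4 x0) (N5 x0); omega
  have hn1 : 1 ≤ n := by omega
  have hv1 := (hvol x0 hx0 n hn4).2
  rw [ncard_ball] at hv1
  have hn0 : (0:ℝ) < n := by exact_mod_cast hn1
  set m := mBound a p q phi x0 n with hm
  have hcard : 0 < (fball a x0 n).card := Finset.card_pos.2 ⟨x0, center_mem a x0 n⟩
  have hcardR : (0:ℝ) < (fball a x0 n).card := by exact_mod_cast hcard
  have hMn1 : 1 ≤ wn (fun x => |max 1 (muA a x)|) (fball a x0 n).card (fball a x0 n) p1 :=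
    wn_ge_one (fun x => (le_max_left _ _).trans (le_abs_self _)) _ hcard (by linarith)
  have hNn1 : 1 ≤ wn (fun x => |max 1 (nuA a x)|) (fball a x0 n).card (fball a x0 n) q1 :=
    wn_ge_one (fun x => (le_max_left _ _).trans (le_abs_self _)) _ hcard (by linarith)
  have hGn0 : 0 ≤ wn (fun x => |carre a phi (fun z => (phi z)⁻¹) x|) (fball a x0 n).card (fball a x0 n) p1 :=
    wn_nonneg (fun x => abs_nonneg _) hcardR _ _
  have hM2 := avg_mono a x0 n (by linarith) hpp (fun x => max 1 (muA a x))
  have hN2 := avg_mono a x0 n (by linarith) hqq (fun x => max 1 (nuA a x))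
  have hG2 := avg_mono a x0 n (by linarith) hpp (carre a phi fun z => (phi z)⁻¹)
  have hmle : wn (fun x => |max 1 (muA a x)|) (fball a x0 n).card (fball a x0 n) p1 *
      wn (fun x => |max 1 (nuA a x)|) (fball a x0 n).card (fball a x0 n) q1 *
      (1 + wn (fun x => |carre a phi (fun z => (phi z)⁻¹) x|) (fball a x0 n).card (fball a x0 n) p1
        * (n:ℝ) ^ 2) ≤ m := by
    rw [hm, mBound]
    have := hMn1.trans hM2
    have := hNn1.trans hN2
    gcongr
  have hm1 : 1 ≤ m := by
    refine le_trans ?_ hmle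
    refine one_le_mul_of_one_le_of_one_le (one_le_mul_of_one_le_of_one_le hMn1 hNn1) ?_
    have := mul_nonneg hGn0 (sq_nonneg (n:ℝ))
    linarith
  have hv : ∀ x, 0 ≤ phi x * u x := fun x => mul_nonneg (hphi x).le (hu x)
  have hmono : ∀ s t : ℝ, s ≤ t → fball a x0 (s * n) ⊆ fball a x0 (t * n) := fun s t hst =>
    fball_mono a x0 (mul_le_mul_of_nonneg_right hst hn0.le)
  have hstep := graph_step hd hs ha hκ hh.1 hn1 hCS1 hCreg hr (hsob x0 hx0 n hn5) hv1 hu hL hphi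
    hζ hq' hp' hP heρ he1 he2 hρ hmle
  have hmoser := moser (fun x => phi x * u x) hv (fun s => fball a x0 (s * n)) hmono hcardR hP0 hρ
    (one_le_mul_of_one_le_of_one_le hA01 hm1) d hstep
  have hA0m : 0 < A0 * m * 2 ^ d := by positivity
  have hinterp := interp (fun x => phi x * u x) hv (fun s => fball a x0 (s * n)) hmono
    (D := (A0 * m * 2 ^ d) ^ S0 * B1) (k := k) (α := α') (P := P) hcardR hα'0 (min_le_right _ _)
    (by positivity) hk0
    (by
      intro s t hs1 hst ht y hy
      have h1 := hmoser s t hs1 hst ht y hy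
      refine h1.trans (le_of_eq ?_)
      have hts : 0 ≤ (t - s)⁻¹ := inv_nonneg.2 (by linarith)
      rw [Real.mul_rpow hA0m.le (by positivity), ← Real.rpow_natCast ((t - s)⁻¹) d, ← Real.rpow_mul hts]
      ring)
    σ' σ hσ' hσσ hσ x (mem_fball.2 hx)
  refine hinterp.trans ?_
  have hτ : 1 ≤ (σ - σ')⁻¹ := (one_le_inv₀ (by linarith)).2 (by linarith)
  have halg := final_alg (T := 2 ^ d) hA01 hm1 hB11 hS0n hk0 hθ0 hτ h2d
  have hsubσ : fball a x0 (σ * n) ⊆ fball a x0 n := fball_mono a x0 (by nlinarith)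
  have hcle : ((fball a x0 (σ * n)).card : ℝ) ≤ (fball a x0 n).card := by
    exact_mod_cast Finset.card_le_card hsubσ
  have hcσ : (0:ℝ) < (fball a x0 (σ * n)).card := by
    exact_mod_cast Finset.card_pos.2 ⟨x0, center_mem a x0 (σ * n)⟩
  have hwn : wn (fun x => phi x * u x) (fball a x0 n).card (fball a x0 (σ * n)) α' ≤
      avgNormR (ENNReal.ofReal α) (ballCh a x0 (σ * n)) (fun z => phi z * u z) := by
    rw [avg_eq a x0 _ ENNReal.ofReal_ne_top, ENNReal.toReal_ofReal hα.le]
    have e : (fun y => |phi y * u y|) = fun y => phi y * u y := funext fun y => abs_of_nonneg (hv y)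
    rw [e]
    exact (wn_jensen hv hcardR _ hcle hα'0 (min_le_left _ _)).trans (wn_const_le hv hcσ hcle _ hα)
  have hwn0 := wn_nonneg hv hcardR (fball a x0 (σ * n)) α'
  rw [div_eq_mul_inv (_ * m), ← inv_pow]
  refine mul_le_mul halg hwn hwn0 ?_
  have : 0 ≤ (σ - σ')⁻¹ := by linarith
  positivity

/-- Proposition `prop:max_ineq`, maximal inequality: under the
graph assumption, for `u ≥ 0` with `ℒu ≥ 0` on `B(1) = B^ω(x₀,n)` and
`v = φ·u`, for every `α > 0` and `p, q` with `1/p + 1/q < 2/d'` there are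
`γ > 1` and `c₃₄ > 0` with
`max_{B(σ')} v ≤ (c₃₄ m^ω(n)/(σ-σ')²)^γ ‖v‖_{α,B(σ)}`. -/
theorem statement15
    {d : ℕ} (hd : 2 ≤ d) (d' Creg CS1 : ℝ)
    (α : ℝ) (hα : 0 < α)
    (p q : ℝ≥0∞) (hp : 1 < p) (hq : 1 < q)
    (hpq : 1 / p + 1 / q < ENNReal.ofReal (2 / d')) :
    ∃ γ c34 : ℝ, 1 < γ ∧ 0 < c34 ∧
      ∀ (a : Vert d → Vert d → ℝ), (∀ x y, a x y = a y x) → (∀ x y, 0 ≤ a x y) →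
      ∀ κ : Vert d → ℝ, (∀ x, 0 < κ x) → ∀ h ∈ Set.Icc (0:ℝ) 1,
      ∀ N4 N5 : Vert d → ℕ, GraphAssumption d' a N4 N5 Creg CS1 →
      ∀ x0 ∈ Cinf a, ∀ n : ℕ, 2 * max (N4 x0) (N5 x0) ≤ n →
      ∀ u : Vert d → ℝ, (∀ x, 0 ≤ u x) →
        (∀ x ∈ ballCh a x0 (n : ℝ), 0 ≤ genL a κ h u x) →
      ∀ phi : Vert d → ℝ, (∀ x, 0 < phi x) →
      ∀ σ' σ : ℝ, 1 / 2 ≤ σ' → σ' < σ → σ ≤ 1 →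
      ∀ x ∈ ballCh a x0 (σ' * n),
        phi x * u x ≤
          (c34 * mBound a p q phi x0 n / (σ - σ') ^ 2) ^ γ *
            avgNormR (ENNReal.ofReal α) (ballCh a x0 (σ * n))
              (fun z => phi z * u z) := by
  exact main_aux hd d' Creg CS1 α hα p q hp hq hpq

end FPPPaper
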